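/- arXiv:1511.02165 — 2 statements merged into one kernel-verified Lean document; each statement's English description precedes it below -/
import Mathlib

section
/- Assume there exists a constant a > 0 such that ∫_a^∞ dt/√(∫_0^t φ(s) ds) < ∞ (with the convention that the integrand equals +∞ where ∫_0^t φ(s) ds = 0). Then for every r > 0 there exists b > 0 such that R_b = r. -/
open MeasureTheory Real Filter Set
open scoped ENNReal Topology

noncomputable section

/-- The interval [0, R) for an extended-real radius `R`. -/
def odeDom (R : ℝ≥0∞) : Set ℝ := {r : ℝ | 0 ≤ r ∧ ENNReal.ofReal r < R}

/-- `u` is a solution with initial value `a` on `[0, R)` of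
u'' + ((m-1)/r) u' = φ(u), u(0) = a, u'(0) = 0, with `u` nonnegative and C². -/
def IsSolOn (m : ℝ) (φ : ℝ → ℝ) (a : ℝ) (R : ℝ≥0∞) (u : ℝ → ℝ) : Prop :=
  ContDiffOn ℝ 2 u (odeDom R) ∧
  (∀ r ∈ odeDom R, 0 ≤ u r) ∧
  u 0 = a ∧
  derivWithin u (Set.Ici 0) 0 = 0 ∧
  ∀ r : ℝ, 0 < r → ENNReal.ofReal r < R →
    deriv (deriv u) r + ((m - 1) / r) * deriv u r = φ (u r)

/-- The maximal existence radius `R_a`: the supremum of all `R ∈ (0, ∞]` such that a solution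
with initial value `a` exists on `[0, R)`. -/
def maxRadius (m : ℝ) (φ : ℝ → ℝ) (a : ℝ) : ℝ≥0∞ :=
  sSup {R : ℝ≥0∞ | 0 < R ∧ ∃ u : ℝ → ℝ, IsSolOn m φ a R u}

/-- A function with nonnegative derivative does not decrease. -/
lemma le_of_hasDerivAt_nonneg {f f' : ℝ → ℝ} {a b : ℝ} (hab : a ≤ b)
    (hc : ContinuousOn f (Icc a b)) (hf : ∀ x ∈ Ioo a b, HasDerivAt f (f' x) x)
    (h0 : ∀ x ∈ Ioo a b, 0 ≤ f' x) : f a ≤ f b := by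
  have hmono : MonotoneOn f (Icc a b) := by
    apply monotoneOn_of_deriv_nonneg (convex_Icc a b) hc
    · intro x hx
      rw [interior_Icc] at hx
      exact (hf x hx).differentiableAt.differentiableWithinAt
    · intro x hx
      rw [interior_Icc] at hx
      rw [(hf x hx).deriv]
      exact h0 x hx
  exact hmono (left_mem_Icc.2 hab) (right_mem_Icc.2 hab) hab

/-- The radial flux `t ↦ t ∫₀¹ σ^(m-1) g(tσ) dσ = t^(1-m) ∫₀ᵗ s^(m-1) g(s) ds`, the derivative of
the radial solution of `Δu = g` in dimension `m`. -/
def radialFlux (m : ℝ) (g : ℝ → ℝ) (t : ℝ) : ℝ :=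
  t * ∫ σ in (0:ℝ)..1, σ ^ (m - 1) * g (t * σ)

/-- The radial solution of `Δu = g`, `u(0) = b` in dimension `m`. -/
def radialPotential (m b : ℝ) (g : ℝ → ℝ) (r : ℝ) : ℝ :=
  b + ∫ t in (0:ℝ)..r, radialFlux m g t

lemma continuous_rpow_sub_one {m : ℝ} (hm : 1 < m) : Continuous fun σ : ℝ => σ ^ (m - 1) :=
  continuous_id.rpow_const fun _ => Or.inr (by linarith)

lemma continuous_radialFlux_uncurry {X : Type*} [TopologicalSpace X] {m : ℝ} (hm : 1 < m)
    {G : X → ℝ → ℝ} (hG : Continuous (Function.uncurry G)) :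
    Continuous fun p : X × ℝ => radialFlux m (G p.1) p.2 := by
  unfold radialFlux
  refine continuous_snd.mul ?_
  apply intervalIntegral.continuous_parametric_intervalIntegral_of_continuous'
  have h1 : Continuous fun q : (X × ℝ) × ℝ => (q.1.1, q.1.2 * q.2) := by fun_prop
  exact ((continuous_rpow_sub_one hm).comp continuous_snd).mul (hG.comp h1)

lemma continuous_radialFlux {m : ℝ} (hm : 1 < m) {g : ℝ → ℝ} (hg : Continuous g) :
    Continuous (radialFlux m g) := by
  have h := continuous_radialFlux_uncurry (X := Unit) hm (G := fun _ => g)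
    (hg.comp continuous_snd)
  exact h.comp (by fun_prop : Continuous fun t : ℝ => ((), t))

lemma continuous_radialPotential_uncurry {m : ℝ} (hm : 1 < m)
    {G : ℝ → ℝ → ℝ} (hG : Continuous (Function.uncurry G)) :
    Continuous (Function.uncurry fun b r => radialPotential m b (G b) r) := by
  unfold radialPotential Function.uncurry
  refine continuous_fst.add ?_
  apply intervalIntegral.continuous_parametric_intervalIntegral_of_continuous _ continuous_snd
  exact (continuous_radialFlux_uncurry hm hG).comp
    (by fun_prop : Continuous fun q : (ℝ × ℝ) × ℝ => (q.1.1, q.2))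

lemma hasDerivAt_radialPotential {m : ℝ} (hm : 1 < m) (b : ℝ) {g : ℝ → ℝ} (hg : Continuous g)
    (r : ℝ) : HasDerivAt (radialPotential m b g) (radialFlux m g r) r :=
  (((continuous_radialFlux hm hg).integral_hasStrictDerivAt 0 r).hasDerivAt).const_add b

lemma continuous_radialPotential {m : ℝ} (hm : 1 < m) (b : ℝ) {g : ℝ → ℝ} (hg : Continuous g) :
    Continuous (radialPotential m b g) :=
  continuous_iff_continuousAt.2 fun r => (hasDerivAt_radialPotential hm b hg r).continuousAt

@[simp] lemma radialPotential_zero (m b : ℝ) (g : ℝ → ℝ) : radialPotential m b g 0 = b := by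
  simp [radialPotential]

@[simp] lemma radialFlux_zero (m : ℝ) (g : ℝ → ℝ) : radialFlux m g 0 = 0 := by
  simp [radialFlux]

lemma radialFlux_const {m : ℝ} (hm : 1 < m) (c t : ℝ) : radialFlux m (fun _ => c) t = t * c / m := by
  unfold radialFlux
  rw [intervalIntegral.integral_mul_const, integral_rpow (Or.inl (by linarith))]
  rw [Real.one_rpow, Real.zero_rpow (by linarith)]
  rw [sub_add_cancel]
  ring

lemma intervalIntegrable_radialFlux_aux {m : ℝ} (hm : 1 < m) {g : ℝ → ℝ} (hg : Continuous g)
    (t a b : ℝ) : IntervalIntegrable (fun σ : ℝ => σ ^ (m - 1) * g (t * σ)) volume a b :=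
  ((continuous_rpow_sub_one hm).mul (by fun_prop)).intervalIntegrable _ _

lemma radialFlux_mono {m : ℝ} (hm : 1 < m) {f g : ℝ → ℝ} (hf : Continuous f) (hg : Continuous g)
    {t : ℝ} (ht : 0 ≤ t) (hfg : ∀ s ∈ Icc 0 t, f s ≤ g s) :
    radialFlux m f t ≤ radialFlux m g t := by
  unfold radialFlux
  refine mul_le_mul_of_nonneg_left ?_ ht
  apply intervalIntegral.integral_mono_on zero_le_one (intervalIntegrable_radialFlux_aux hm hf _ _ _)
    (intervalIntegrable_radialFlux_aux hm hg _ _ _)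
  intro σ hσ
  refine mul_le_mul_of_nonneg_left (hfg _ ⟨by have := hσ.1; positivity, ?_⟩)
    (Real.rpow_nonneg hσ.1 _)
  nlinarith [hσ.2]

lemma radialFlux_nonneg {m : ℝ} (hm : 1 < m) {g : ℝ → ℝ} (hg : Continuous g)
    {t : ℝ} (ht : 0 ≤ t) (h0 : ∀ s ∈ Icc 0 t, 0 ≤ g s) : 0 ≤ radialFlux m g t := by
  have := radialFlux_mono hm (continuous_const (y := (0:ℝ))) hg ht h0
  simpa [radialFlux_const hm] using this

lemma radialPotential_mono {m : ℝ} (hm : 1 < m) {f g : ℝ → ℝ} (hf : Continuous f)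
    (hg : Continuous g) {b c r : ℝ} (hbc : b ≤ c) (hr : 0 ≤ r) (hfg : ∀ s ∈ Icc 0 r, f s ≤ g s) :
    radialPotential m b f r ≤ radialPotential m c g r := by
  unfold radialPotential
  refine add_le_add hbc ?_
  apply intervalIntegral.integral_mono_on hr
    ((continuous_radialFlux hm hf).intervalIntegrable _ _)
    ((continuous_radialFlux hm hg).intervalIntegrable _ _)
  intro t ht
  exact radialFlux_mono hm hf hg ht.1 fun s hs => hfg s ⟨hs.1, hs.2.trans ht.2⟩

lemma radialPotential_congr {m : ℝ} (hm : 1 < m) {f g : ℝ → ℝ} (hf : Continuous f)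
    (hg : Continuous g) {b r : ℝ} (hr : 0 ≤ r) (hfg : ∀ s ∈ Icc 0 r, f s = g s) :
    radialPotential m b f r = radialPotential m b g r :=
  le_antisymm (radialPotential_mono hm hf hg le_rfl hr fun s hs => (hfg s hs).le)
    (radialPotential_mono hm hg hf le_rfl hr fun s hs => (hfg s hs).ge)

lemma radialPotential_monotoneOn {m : ℝ} (hm : 1 < m) {g : ℝ → ℝ} (hg : Continuous g)
    (h0 : ∀ s, 0 ≤ g s) (b : ℝ) {x y : ℝ} (hx : 0 ≤ x) (hxy : x ≤ y) :
    radialPotential m b g x ≤ radialPotential m b g y := by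
  refine le_of_hasDerivAt_nonneg hxy (continuous_radialPotential hm b hg).continuousOn
    (fun t _ => hasDerivAt_radialPotential hm b hg t) fun t ht => ?_
  exact radialFlux_nonneg hm hg (hx.trans ht.1.le) fun s _ => h0 s

/-- The derivative of the radial flux. -/
def radialFluxDeriv (m : ℝ) (g : ℝ → ℝ) (t : ℝ) : ℝ :=
  g t - (m - 1) * ∫ σ in (0:ℝ)..1, σ ^ (m - 1) * g (t * σ)

lemma continuous_radialFluxDeriv {m : ℝ} (hm : 1 < m) {g : ℝ → ℝ} (hg : Continuous g) :
    Continuous (radialFluxDeriv m g) := by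
  unfold radialFluxDeriv
  refine hg.sub (continuous_const.mul ?_)
  apply intervalIntegral.continuous_parametric_intervalIntegral_of_continuous'
  exact ((continuous_rpow_sub_one hm).comp continuous_snd).mul
    (hg.comp (by fun_prop : Continuous fun q : ℝ × ℝ => q.1 * q.2))

lemma integral_radialFlux_eq {m : ℝ} (g : ℝ → ℝ) {t : ℝ} (ht : 0 < t) :
    ∫ σ in (0:ℝ)..1, σ ^ (m - 1) * g (t * σ) =
      t ^ (-m) * ∫ s in (0:ℝ)..t, s ^ (m - 1) * g s := by
  have h := intervalIntegral.integral_comp_mul_left (a := 0) (b := 1)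
    (fun s : ℝ => s ^ (m - 1) * g s) ht.ne'
  rw [mul_zero, mul_one, smul_eq_mul] at h
  have h2 : ∫ σ in (0:ℝ)..1, (t * σ) ^ (m - 1) * g (t * σ) =
      t ^ (m - 1) * ∫ σ in (0:ℝ)..1, σ ^ (m - 1) * g (t * σ) := by
    rw [← intervalIntegral.integral_const_mul]
    apply intervalIntegral.integral_congr
    intro σ hσ
    rw [uIcc_of_le zero_le_one] at hσ
    simp only
    rw [Real.mul_rpow ht.le hσ.1]
    ring
  rw [h2] at h
  have h3 : t ^ (-m) = (t ^ (m - 1))⁻¹ * t⁻¹ := by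
    rw [← Real.rpow_neg ht.le, ← Real.rpow_neg_one t, ← Real.rpow_add ht]
    congr 1
    ring
  rw [h3, mul_assoc, ← h, inv_mul_cancel_left₀ (Real.rpow_pos_of_pos ht _).ne']

lemma hasDerivAt_radialFlux_of_pos {m : ℝ} (hm : 1 < m) {g : ℝ → ℝ} (hg : Continuous g) {t : ℝ}
    (ht : 0 < t) : HasDerivAt (radialFlux m g) (radialFluxDeriv m g t) t := by
  have h1 : HasDerivAt (fun t : ℝ => ∫ s in (0:ℝ)..t, s ^ (m - 1) * g s) (t ^ (m - 1) * g t) t :=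
    (((continuous_rpow_sub_one hm).mul hg).integral_hasStrictDerivAt 0 t).hasDerivAt
  have h2 : HasDerivAt (fun t : ℝ => t ^ (1 - m)) ((1 - m) * t ^ (1 - m - 1)) t :=
    Real.hasDerivAt_rpow_const (Or.inl ht.ne')
  have h3 := h2.mul h1
  have h4 : radialFlux m g =ᶠ[𝓝 t]
      (fun t : ℝ => t ^ (1 - m)) * fun t : ℝ => ∫ s in (0:ℝ)..t, s ^ (m - 1) * g s := by
    filter_upwards [lt_mem_nhds ht] with x hx
    simp only [radialFlux, Pi.mul_apply]
    rw [integral_radialFlux_eq g hx, ← mul_assoc]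
    congr 1
    rw [sub_eq_add_neg, Real.rpow_add hx, Real.rpow_one]
  refine (h3.congr_of_eventuallyEq h4).congr_deriv ?_
  unfold radialFluxDeriv
  rw [integral_radialFlux_eq g ht]
  have h5 : t ^ (1 - m) * t ^ (m - 1) = 1 := by
    rw [← Real.rpow_add ht]; simp
  have h6 : 1 - m - 1 = -m := by ring
  rw [h6, ← mul_assoc, h5]
  ring

lemma hasDerivAt_radialFlux {m : ℝ} (hm : 1 < m) {g : ℝ → ℝ} (hg : Continuous g) (t : ℝ) :
    HasDerivAt (radialFlux m g) (radialFluxDeriv m g t) t := by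
  refine hasDerivAt_of_hasDerivAt_of_ne' (x := 0) (fun y hy => ?_)
    (continuous_radialFlux hm hg).continuousAt (continuous_radialFluxDeriv hm hg).continuousAt t
  rcases lt_or_gt_of_ne hy with hy | hy
  · have hg' : Continuous fun s => g (-s) := hg.comp continuous_neg
    have h := hasDerivAt_radialFlux_of_pos hm hg' (neg_pos.2 hy)
    have h2 := (h.comp y (hasDerivAt_neg y)).neg
    refine (h2.congr_deriv ?_).congr_of_eventuallyEq (Eventually.of_forall fun x => ?_)
    · simp [radialFluxDeriv]
    · simp [radialFlux]
  · exact hasDerivAt_radialFlux_of_pos hm hg hy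

lemma radialFluxDeriv_eq {m : ℝ} (g : ℝ → ℝ) {t : ℝ} (ht : t ≠ 0) :
    radialFluxDeriv m g t = g t - (m - 1) / t * radialFlux m g t := by
  unfold radialFluxDeriv radialFlux
  field_simp

lemma div_le_radialFluxDeriv {m : ℝ} (hm : 1 < m) {g : ℝ → ℝ} (hg : Continuous g)
    (hmono : Monotone g) {t : ℝ} (ht : 0 ≤ t) : g t / m ≤ radialFluxDeriv m g t := by
  have h1 : ∫ σ in (0:ℝ)..1, σ ^ (m - 1) * g (t * σ) ≤ ∫ σ in (0:ℝ)..1, σ ^ (m - 1) * g t := by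
    apply intervalIntegral.integral_mono_on zero_le_one
      (intervalIntegrable_radialFlux_aux hm hg _ _ _)
      (((continuous_rpow_sub_one hm).mul continuous_const).intervalIntegrable _ _)
    intro σ hσ
    refine mul_le_mul_of_nonneg_left (hmono ?_) (Real.rpow_nonneg hσ.1 _)
    nlinarith [hσ.2]
  have h2 : ∫ σ in (0:ℝ)..1, σ ^ (m - 1) * g t = g t / m := by
    have := radialFlux_const hm (g t) 1
    simpa [radialFlux] using this
  rw [h2] at h1
  unfold radialFluxDeriv
  have h3 := mul_le_mul_of_nonneg_left h1 (by linarith : 0 ≤ m - 1)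
  have h4 : (m - 1) * (g t / m) = g t - g t / m := by
    have : m ≠ 0 := by linarith
    field_simp
  linarith

lemma contDiff_radialPotential {m : ℝ} (hm : 1 < m) (b : ℝ) {g : ℝ → ℝ} (hg : Continuous g) :
    ContDiff ℝ 2 (radialPotential m b g) := by
  have h1 : deriv (radialPotential m b g) = radialFlux m g :=
    funext fun r => (hasDerivAt_radialPotential hm b hg r).deriv
  have h2 : deriv (radialFlux m g) = radialFluxDeriv m g :=
    funext fun r => (hasDerivAt_radialFlux hm hg r).deriv
  rw [show (2 : WithTop ℕ∞) = 1 + 1 by norm_num, contDiff_succ_iff_deriv]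
  refine ⟨fun r => (hasDerivAt_radialPotential hm b hg r).differentiableAt, by simp, ?_⟩
  rw [h1, contDiff_one_iff_deriv, h2]
  exact ⟨fun r => (hasDerivAt_radialFlux hm hg r).differentiableAt,
    continuous_radialFluxDeriv hm hg⟩

/-- Under the Keller–Osserman condition, `1 / √Φ` has an antiderivative with a finite limit. -/
lemma exists_bounded_antideriv {ψ : ℝ → ℝ} (hψ : Continuous ψ) (h0 : ∀ t, 0 ≤ ψ t)
    (hKO : ∃ a : ℝ, 0 < a ∧
      ∫⁻ t in Set.Ioi a, (ENNReal.ofReal (Real.sqrt (∫ s in (0:ℝ)..t, ψ s)))⁻¹ < ⊤) :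
    ∃ a : ℝ, 0 < a ∧ ∃ H : ℝ → ℝ, ∃ L : ℝ, Tendsto H atTop (𝓝 L) ∧
      ∀ t, a < t → 0 < (∫ s in (0:ℝ)..t, ψ s) ∧
        HasDerivAt H (Real.sqrt (∫ s in (0:ℝ)..t, ψ s))⁻¹ t := by
  obtain ⟨a, ha, hfin⟩ := hKO
  set Φ : ℝ → ℝ := fun t => ∫ s in (0:ℝ)..t, ψ s with hΦ
  have hderiv : ∀ t, HasDerivAt Φ (ψ t) t := fun t =>
    (hψ.integral_hasStrictDerivAt 0 t).hasDerivAt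
  have hcont : Continuous Φ := continuous_iff_continuousAt.2 fun t => (hderiv t).continuousAt
  have hΦmono : Monotone Φ := by
    intro x y hxy
    exact le_of_hasDerivAt_nonneg hxy hcont.continuousOn (fun t _ => hderiv t) fun t _ => h0 t
  have hpos : ∀ t, a < t → 0 < Φ t := by
    intro t ht
    by_contra hle
    push Not at hle
    have h1 : ∫⁻ x in Ioc a t, (⊤ : ℝ≥0∞) ≤
        ∫⁻ x in Ioi a, (ENNReal.ofReal (Real.sqrt (Φ x)))⁻¹ := by
      refine le_trans ?_ (lintegral_mono_set (Ioc_subset_Ioi_self : Ioc a t ⊆ Ioi a))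
      refine setLIntegral_mono' measurableSet_Ioc fun x hx => ?_
      rw [Real.sqrt_eq_zero_of_nonpos ((hΦmono hx.2).trans hle)]
      simp
    rw [setLIntegral_const, Real.volume_Ioc, ENNReal.top_mul (by simpa using ht)] at h1
    exact absurd (h1.trans_lt hfin) (lt_irrefl _)
  have hmeas : Measurable fun t => (Real.sqrt (Φ t))⁻¹ := hcont.sqrt.measurable.inv
  have hint : IntegrableOn (fun t => (Real.sqrt (Φ t))⁻¹) (Ioi a) := by
    refine ⟨hmeas.aestronglyMeasurable, ?_⟩
    unfold HasFiniteIntegral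
    refine lt_of_le_of_lt (setLIntegral_mono' measurableSet_Ioi fun x hx => ?_) hfin
    rw [Real.enorm_eq_ofReal (by positivity),
      ENNReal.ofReal_inv_of_pos (Real.sqrt_pos.2 (hpos x hx))]
  refine ⟨a + 1, by linarith, fun y => ∫ t in (a+1)..y, (Real.sqrt (Φ t))⁻¹, _,
    intervalIntegral_tendsto_integral_Ioi (a + 1)
      (hint.mono_set (Ioi_subset_Ioi (by linarith))) tendsto_id, fun t ht => ?_⟩
  have hpt := hpos t (by linarith)
  refine ⟨hpt, intervalIntegral.integral_hasDerivAt_right ?_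
    hmeas.stronglyMeasurable.stronglyMeasurableAtFilter ?_⟩
  · rw [intervalIntegrable_iff_integrableOn_Ioc_of_le ht.le]
    exact hint.mono_set fun x hx => lt_trans (by linarith) hx.1
  · exact hcont.sqrt.continuousAt.inv₀ (Real.sqrt_pos.2 hpt).ne'

/-- Keller–Osserman: a nondecreasing function with `u'' ≥ ψ(u)/m` on an interval of length `ε`
has a starting value bounded in terms of `ε` only. -/
lemma exists_bound_of_kellerOsserman {m : ℝ} (hm : 1 < m) {ψ : ℝ → ℝ} (hψ : Continuous ψ)
    (hmono : Monotone ψ) (h0 : ∀ t, 0 ≤ ψ t)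
    (hKO : ∃ a : ℝ, 0 < a ∧
      ∫⁻ t in Set.Ioi a, (ENNReal.ofReal (Real.sqrt (∫ s in (0:ℝ)..t, ψ s)))⁻¹ < ⊤)
    {ε : ℝ} (hε : 0 < ε) :
    ∃ A : ℝ, ∀ (x₀ : ℝ) (u p q : ℝ → ℝ),
      (∀ x, HasDerivAt u (p x) x) → (∀ x, HasDerivAt p (q x) x) → 0 ≤ p x₀ →
      (∀ x ∈ Icc x₀ (x₀ + ε), ψ (u x) / m ≤ q x) → u x₀ < A := by
  obtain ⟨a, ha, H, L, hL, hH⟩ := exists_bounded_antideriv hψ h0 hKO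
  set Φ : ℝ → ℝ := fun t => ∫ s in (0:ℝ)..t, ψ s with hΦ
  have hderiv : ∀ t, HasDerivAt Φ (ψ t) t := fun t =>
    (hψ.integral_hasStrictDerivAt 0 t).hasDerivAt
  have hcont : Continuous Φ := continuous_iff_continuousAt.2 fun t => (hderiv t).continuousAt
  have hΦmono : Monotone Φ := by
    intro x y hxy
    exact le_of_hasDerivAt_nonneg hxy hcont.continuousOn (fun t _ => hderiv t) fun t _ => h0 t
  have hm0 : 0 < m := by linarith
  set δ : ℝ := ε / (8 * √m) with hδ
  have hsm : 0 < √m := Real.sqrt_pos.2 hm0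
  have hδ0 : 0 < δ := by positivity
  obtain ⟨B, hB⟩ := (Metric.tendsto_atTop.1 hL) (δ / 2) (by positivity)
  have hdiff : ∀ y z, B ≤ y → B ≤ z → H z - H y < δ := by
    intro y z hy hz
    have h1 := abs_lt.1 (Real.dist_eq _ _ ▸ hB y hy)
    have h2 := abs_lt.1 (Real.dist_eq _ _ ▸ hB z hz)
    linarith [h1.1, h2.2]
  refine ⟨2 * (|B| + a + 1), fun x₀ u p q hu hp hp0 hq => ?_⟩
  by_contra hA
  push Not at hA
  set A := u x₀ with hAdef
  have hB1 := le_abs_self B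
  have hB2 := abs_nonneg B
  have hA0 : 0 < A := by linarith
  have hcu : Continuous u := continuous_iff_continuousAt.2 fun t => (hu t).continuousAt
  have hcp : Continuous p := continuous_iff_continuousAt.2 fun t => (hp t).continuousAt
  -- the starting value is dominated by `ψ A`
  have hΦA : Φ A ≤ A * ψ A := by
    have := le_of_hasDerivAt_nonneg (f := fun t => t * ψ A - Φ t) (f' := fun t => 1 * ψ A - ψ t)
      hA0.le (by fun_prop) (fun t _ => ((hasDerivAt_id t).mul_const _).sub (hderiv t))
      (fun t ht => by have := hmono ht.2.le; linarith)
    have hz : Φ 0 = 0 := by simp [hΦ]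
    simp only [hz] at this
    linarith
  have hΦApos : 0 < Φ A := (hH A (by linarith)).1
  have hsqA : 0 < √(Φ A) := Real.sqrt_pos.2 hΦApos
  have hA2 : A / 2 * (√(Φ A))⁻¹ < δ := by
    have hcH : ContinuousOn (fun t => H t - t * (√(Φ A))⁻¹) (Icc (A / 2) A) := by
      intro t ht
      have : ContinuousAt H t := (hH t (by linarith [ht.1])).2.continuousAt
      exact (this.sub (by fun_prop)).continuousWithinAt
    have := le_of_hasDerivAt_nonneg (f := fun t => H t - t * (√(Φ A))⁻¹)
      (f' := fun t => (√(Φ t))⁻¹ - 1 * (√(Φ A))⁻¹) (by linarith : A / 2 ≤ A) hcH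
      (fun t ht => ((hH t (by linarith [ht.1])).2).sub ((hasDerivAt_id t).mul_const _))
      (fun t ht => by
        have h1 := (hH t (by linarith [ht.1])).1
        have h2 : (√(Φ A))⁻¹ ≤ (√(Φ t))⁻¹ :=
          inv_anti₀ (Real.sqrt_pos.2 h1) (Real.sqrt_le_sqrt (hΦmono ht.2.le))
        linarith)
    have h3 := hdiff (A / 2) A (by linarith) (by linarith)
    linarith
  have hA3 : A < 4 * δ ^ 2 * ψ A := by
    have h1 : A / 2 < δ * √(Φ A) := by
      rwa [← div_eq_mul_inv, div_lt_iff₀ hsqA] at hA2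
    have h2 : (A / 2) ^ 2 < (δ * √(Φ A)) ^ 2 := by gcongr
    rw [mul_pow, Real.sq_sqrt hΦApos.le] at h2
    have h3 : A * A < A * (4 * δ ^ 2 * ψ A) := by nlinarith [sq_nonneg δ]
    exact lt_of_mul_lt_mul_left h3 hA0.le
  -- monotonicity
  have hp_nonneg : ∀ x ∈ Icc x₀ (x₀ + ε), 0 ≤ p x := by
    intro x hx
    refine hp0.trans (le_of_hasDerivAt_nonneg hx.1 hcp.continuousOn (fun t _ => hp t) ?_)
    intro t ht
    exact (div_nonneg (h0 _) hm0.le).trans (hq t ⟨ht.1.le, ht.2.le.trans hx.2⟩)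
  have hu_mono : ∀ x y, x₀ ≤ x → x ≤ y → y ≤ x₀ + ε → u x ≤ u y := by
    intro x y hx hxy hy
    refine le_of_hasDerivAt_nonneg hxy hcu.continuousOn (fun t _ => hu t) ?_
    intro t ht
    exact hp_nonneg t ⟨hx.trans ht.1.le, ht.2.le.trans hy⟩
  have hp_lower : ∀ x ∈ Icc x₀ (x₀ + ε), ψ A / m * (x - x₀) ≤ p x := by
    intro x hx
    have := le_of_hasDerivAt_nonneg (f := fun t => p t - ψ A / m * (t - x₀))
      (f' := fun t => q t - ψ A / m * 1) hx.1 (by fun_prop)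
      (fun t _ => (hp t).sub (((hasDerivAt_id t).sub_const x₀).const_mul _)) (fun t ht => by
        have h1 := hq t ⟨ht.1.le, ht.2.le.trans hx.2⟩
        have h2 : ψ A ≤ ψ (u t) := hmono (hu_mono x₀ t le_rfl ht.1.le (ht.2.le.trans hx.2))
        have h3 : ψ A / m ≤ ψ (u t) / m := by gcongr
        linarith)
    simp only [sub_self, mul_zero, sub_zero] at this
    linarith
  -- after half of the interval the solution has doubled
  have hdouble : 2 * A ≤ u (x₀ + ε / 2) := by
    have := le_of_hasDerivAt_nonneg (f := fun t => u t - ψ A / (2 * m) * (t - x₀) ^ 2)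
      (f' := fun t => p t - ψ A / (2 * m) * ((2 : ℕ) * (t - x₀) ^ (2 - 1) * 1))
      (by linarith : x₀ ≤ x₀ + ε / 2) (by fun_prop)
      (fun t _ => (hu t).sub ((((hasDerivAt_id t).sub_const x₀).pow 2).const_mul _))
      (fun t ht => by
        have h1 := hp_lower t ⟨ht.1.le, by linarith [ht.2]⟩
        have h2 : ψ A / (2 * m) * ((2 : ℕ) * (t - x₀) ^ (2 - 1) * 1) = ψ A / m * (t - x₀) := by
          push_cast
          field_simp
        rw [h2]
        linarith)
    simp only [sub_self, add_sub_cancel_left] at this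
    have h4 : 4 * δ ^ 2 * ψ A = ψ A / (2 * m) * (ε / 2) ^ 2 / 2 := by
      have : δ ^ 2 = ε ^ 2 / (64 * m) := by
        rw [hδ, div_pow, mul_pow, Real.sq_sqrt hm0.le]; norm_num
      rw [this]
      field_simp
      ring
    have h5 : 0 ≤ ψ A := h0 A
    have h6 : 0 ≤ 4 * δ ^ 2 * ψ A := by positivity
    norm_num at this
    linarith
  have hΦ2 : ∀ t, 2 * A ≤ t → 2 * Φ A ≤ Φ t := by
    intro t ht
    have := le_of_hasDerivAt_nonneg (f := fun t => Φ t - t * ψ A) (f' := fun t => ψ t - 1 * ψ A)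
      (by linarith : A ≤ 2 * A) (by fun_prop)
      (fun t _ => (hderiv t).sub ((hasDerivAt_id t).mul_const _))
      (fun t ht => by have := hmono ht.1.le; linarith)
    have h2 := hΦmono ht
    linarith
  have henergy : ∀ x ∈ Icc x₀ (x₀ + ε), 2 / m * (Φ (u x) - Φ A) ≤ p x ^ 2 := by
    intro x hx
    have := le_of_hasDerivAt_nonneg (f := fun t => p t ^ 2 - 2 / m * Φ (u t))
      (f' := fun t => (2 : ℕ) * p t ^ (2 - 1) * q t - 2 / m * (ψ (u t) * p t)) hx.1
      (by fun_prop)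
      (fun t _ => ((hp t).pow 2).sub (((hderiv (u t)).comp t (hu t)).const_mul _))
      (fun t ht => by
        have h1 := hq t ⟨ht.1.le, ht.2.le.trans hx.2⟩
        have h2 := hp_nonneg t ⟨ht.1.le, ht.2.le.trans hx.2⟩
        have h3 : 2 / m * (ψ (u t) * p t) = 2 * p t * (ψ (u t) / m) := by ring
        have h4 := mul_le_mul_of_nonneg_left h1 (by linarith : 0 ≤ 2 * p t)
        rw [h3]
        norm_num
        linarith)
    simp only [← hAdef] at this
    nlinarith [sq_nonneg (p x₀)]
  have hspeed : ∀ x ∈ Icc (x₀ + ε / 2) (x₀ + ε), (√m)⁻¹ ≤ (√(Φ (u x)))⁻¹ * p x := by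
    intro x hx
    have hxI : x ∈ Icc x₀ (x₀ + ε) := ⟨by linarith [hx.1], hx.2⟩
    have h1 := henergy x hxI
    have h2 := hΦ2 (u x) (hdouble.trans (hu_mono _ _ (by linarith) hx.1 hx.2))
    have h3 : Φ (u x) / m ≤ p x ^ 2 := by
      refine le_trans ?_ h1
      rw [div_le_iff₀ hm0]
      have : 2 / m * (Φ (u x) - Φ A) * m = 2 * (Φ (u x) - Φ A) := by field_simp
      rw [this]
      linarith
    have hpos : 0 < Φ (u x) := by linarith
    have h4 := Real.sqrt_le_sqrt h3
    rw [Real.sqrt_sq (hp_nonneg x hxI), Real.sqrt_div hpos.le] at h4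
    have h5 := Real.sqrt_pos.2 hpos
    rw [inv_mul_eq_div, le_div_iff₀ h5]
    calc (√m)⁻¹ * √(Φ (u x)) = √(Φ (u x)) / √m := by ring
      _ ≤ p x := h4
  have hlow : ∀ x ∈ Icc (x₀ + ε / 2) (x₀ + ε), 2 * A ≤ u x := fun x hx =>
    hdouble.trans (hu_mono _ _ (by linarith) hx.1 hx.2)
  have hHu : ∀ x ∈ Icc (x₀ + ε / 2) (x₀ + ε),
      HasDerivAt (fun x => H (u x)) ((√(Φ (u x)))⁻¹ * p x) x := fun x hx =>
    ((hH (u x) (by linarith [hlow x hx])).2).comp x (hu x)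
  have hfinal := le_of_hasDerivAt_nonneg (f := fun x => H (u x) - (√m)⁻¹ * x)
    (f' := fun x => (√(Φ (u x)))⁻¹ * p x - (√m)⁻¹ * 1) (by linarith : x₀ + ε / 2 ≤ x₀ + ε)
    (fun x hx => (((hHu x hx).continuousAt).sub (by fun_prop)).continuousWithinAt)
    (fun x hx => (hHu x ⟨hx.1.le, hx.2.le⟩).sub ((hasDerivAt_id x).const_mul _))
    (fun x hx => by linarith [hspeed x ⟨hx.1.le, hx.2.le⟩])
  have hlast := hdiff (u (x₀ + ε / 2)) (u (x₀ + ε)) (by linarith)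
    (by linarith [hlow (x₀ + ε) ⟨by linarith, le_rfl⟩])
  have hδ2 : δ = (√m)⁻¹ * ε / 8 := by rw [hδ]; field_simp
  have : 0 < (√m)⁻¹ * ε := by positivity
  nlinarith

lemma radialFlux_le_add_const {m : ℝ} (hm : 1 < m) {f g : ℝ → ℝ} (hf : Continuous f)
    (hg : Continuous g) {t c : ℝ} (ht : 0 ≤ t) (hfg : ∀ s ∈ Icc 0 t, f s ≤ g s + c) :
    radialFlux m f t ≤ radialFlux m g t + t * c / m := by
  refine (radialFlux_mono hm hf (hg.add (continuous_const (y := c))) ht hfg).trans_eq ?_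
  rw [← radialFlux_const hm c t]
  unfold radialFlux
  rw [← mul_add, ← intervalIntegral.integral_add (intervalIntegrable_radialFlux_aux hm hg _ _ _)
    (intervalIntegrable_radialFlux_aux hm (continuous_const (y := c)) t _ _)]
  simp only [Pi.add_apply, mul_add]

lemma abs_radialFlux_le {m : ℝ} {g : ℝ → ℝ} {c : ℝ} (hm : 1 < m) (h : ∀ s, |g s| ≤ c) (t : ℝ) :
    |radialFlux m g t| ≤ |t| * c := by
  unfold radialFlux
  rw [abs_mul]
  refine mul_le_mul_of_nonneg_left ?_ (abs_nonneg t)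
  have := intervalIntegral.norm_integral_le_of_norm_le_const (a := 0) (b := 1) (C := c)
    (f := fun σ : ℝ => σ ^ (m - 1) * g (t * σ)) (fun σ hσ => ?_)
  · simpa using this
  · rw [uIoc_of_le zero_le_one] at hσ
    rw [Real.norm_eq_abs, abs_mul, abs_of_nonneg (Real.rpow_nonneg hσ.1.le _)]
    have h1 : σ ^ (m - 1) ≤ 1 := Real.rpow_le_one hσ.1.le hσ.2 (by linarith)
    calc σ ^ (m - 1) * |g (t * σ)| ≤ 1 * |g (t * σ)| := by gcongr
      _ ≤ c := by rw [one_mul]; exact h _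

lemma tendsto_radialFlux {m : ℝ} (hm : 1 < m) {G : ℕ → ℝ → ℝ} {g : ℝ → ℝ} {c : ℝ}
    (hG : ∀ k, Continuous (G k)) (hb : ∀ k s, |G k s| ≤ c)
    (hlim : ∀ s, Tendsto (fun k => G k s) atTop (𝓝 (g s))) (t : ℝ) :
    Tendsto (fun k => radialFlux m (G k) t) atTop (𝓝 (radialFlux m g t)) := by
  unfold radialFlux
  refine Tendsto.const_mul t ?_
  apply intervalIntegral.tendsto_integral_filter_of_dominated_convergence (fun _ => c)
  · exact Eventually.of_forall fun k =>
      ((continuous_rpow_sub_one hm).mul ((hG k).comp (by fun_prop))).aestronglyMeasurable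
  · refine Eventually.of_forall fun k => ae_of_all _ fun σ hσ => ?_
    rw [uIoc_of_le zero_le_one] at hσ
    rw [Real.norm_eq_abs, abs_mul, abs_of_nonneg (Real.rpow_nonneg hσ.1.le _)]
    have h1 : σ ^ (m - 1) ≤ 1 := Real.rpow_le_one hσ.1.le hσ.2 (by linarith)
    calc σ ^ (m - 1) * |G k (t * σ)| ≤ 1 * |G k (t * σ)| := by gcongr
      _ ≤ c := by rw [one_mul]; exact hb _ _
  · exact intervalIntegrable_const
  · exact ae_of_all _ fun σ _ => (hlim _).const_mul _

lemma tendsto_radialPotential {m : ℝ} (hm : 1 < m) (b : ℝ) {G : ℕ → ℝ → ℝ} {g : ℝ → ℝ} {c : ℝ}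
    (hG : ∀ k, Continuous (G k)) (hb : ∀ k s, |G k s| ≤ c)
    (hlim : ∀ s, Tendsto (fun k => G k s) atTop (𝓝 (g s))) (r : ℝ) :
    Tendsto (fun k => radialPotential m b (G k) r) atTop (𝓝 (radialPotential m b g r)) := by
  unfold radialPotential
  refine Tendsto.const_add b ?_
  apply intervalIntegral.tendsto_integral_filter_of_dominated_convergence (fun t => |t| * c)
  · exact Eventually.of_forall fun k => (continuous_radialFlux hm (hG k)).aestronglyMeasurable
  · exact Eventually.of_forall fun k => ae_of_all _ fun t _ => abs_radialFlux_le hm (hb k) t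
  · exact (by fun_prop : Continuous fun t : ℝ => |t| * c).intervalIntegrable _ _
  · exact ae_of_all _ fun t _ => tendsto_radialFlux hm hG hb hlim t

/-- Monotone iteration for the radial problem, started at zero. -/
def radialIterate (m : ℝ) (ψ : ℝ → ℝ) (b : ℝ) : ℕ → ℝ → ℝ
  | 0 => fun _ => 0
  | k + 1 => radialPotential m b fun s => ψ (radialIterate m ψ b k s)

lemma continuous_radialIterate_uncurry {m : ℝ} (hm : 1 < m) {ψ : ℝ → ℝ} (hψ : Continuous ψ)
    (k : ℕ) : Continuous (Function.uncurry fun b r => radialIterate m ψ b k r) := by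
  induction k with
  | zero => exact continuous_const
  | succ k ih =>
    exact continuous_radialPotential_uncurry hm (G := fun b s => ψ (radialIterate m ψ b k s))
      (hψ.comp ih)

lemma continuous_radialIterate {m : ℝ} (hm : 1 < m) {ψ : ℝ → ℝ} (hψ : Continuous ψ) (b : ℝ)
    (k : ℕ) : Continuous (radialIterate m ψ b k) :=
  (continuous_radialIterate_uncurry hm hψ k).comp (by fun_prop : Continuous fun r : ℝ => (b, r))

lemma radialIterate_mono_right {m : ℝ} (hm : 1 < m) {ψ : ℝ → ℝ} (hψ : Continuous ψ)
    (h0 : ∀ t, 0 ≤ ψ t) (b : ℝ) (k : ℕ) {x y : ℝ} (hx : 0 ≤ x) (hxy : x ≤ y) :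
    radialIterate m ψ b k x ≤ radialIterate m ψ b k y := by
  cases k with
  | zero => exact le_rfl
  | succ k =>
    exact radialPotential_monotoneOn hm (hψ.comp (continuous_radialIterate hm hψ b k))
      (fun s => h0 _) b hx hxy

lemma radialIterate_nonneg {m : ℝ} (hm : 1 < m) {ψ : ℝ → ℝ} (hψ : Continuous ψ)
    (h0 : ∀ t, 0 ≤ ψ t) {b : ℝ} (hb : 0 ≤ b) (k : ℕ) {x : ℝ} (hx : 0 ≤ x) :
    0 ≤ radialIterate m ψ b k x := by
  refine le_trans ?_ (radialIterate_mono_right hm hψ h0 b k le_rfl hx)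
  cases k with
  | zero => exact le_rfl
  | succ k => simpa [radialIterate] using hb

lemma radialIterate_le_succ {m : ℝ} (hm : 1 < m) {ψ : ℝ → ℝ} (hψ : Continuous ψ)
    (hmono : Monotone ψ) (h0 : ∀ t, 0 ≤ ψ t) {b : ℝ} (hb : 0 ≤ b) (k : ℕ) :
    ∀ x, 0 ≤ x → radialIterate m ψ b k x ≤ radialIterate m ψ b (k + 1) x := by
  induction k with
  | zero => exact fun x hx => radialIterate_nonneg hm hψ h0 hb 1 hx
  | succ k ih =>
    exact fun x hx => radialPotential_mono hm (hψ.comp (continuous_radialIterate hm hψ b k))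
      (hψ.comp (continuous_radialIterate hm hψ b (k + 1))) le_rfl hx
      fun s hs => hmono (ih s hs.1)

lemma radialIterate_mono_left {m : ℝ} (hm : 1 < m) {ψ : ℝ → ℝ} (hψ : Continuous ψ)
    (hmono : Monotone ψ) {b c : ℝ} (hbc : b ≤ c) (k : ℕ) :
    ∀ x, 0 ≤ x → radialIterate m ψ b k x ≤ radialIterate m ψ c k x := by
  induction k with
  | zero => exact fun x hx => le_rfl
  | succ k ih =>
    exact fun x hx => radialPotential_mono hm (hψ.comp (continuous_radialIterate hm hψ b k))
      (hψ.comp (continuous_radialIterate hm hψ c k)) hbc hx fun s hs => hmono (ih s hs.1)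

/-- If the iterates stay bounded at `r`, they converge on `[0, r]` to a solution of the integral
equation, extended here by constants. -/
lemma exists_radial_fixedPoint {m : ℝ} (hm : 1 < m) {ψ : ℝ → ℝ} (hψ : Continuous ψ)
    (hmono : Monotone ψ) (h0 : ∀ t, 0 ≤ ψ t) {b r C : ℝ} (hb : 0 ≤ b) (hr : 0 ≤ r)
    (hC : ∀ k, radialIterate m ψ b k r ≤ C) :
    ∃ v : ℝ → ℝ, Continuous v ∧ Monotone v ∧ (∀ x, 0 ≤ v x) ∧
      (∀ x ∈ Icc 0 r, radialPotential m b (fun s => ψ (v s)) x = v x) ∧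
      ∀ k, ∀ x ∈ Icc 0 r, radialIterate m ψ b k x ≤ v x := by
  have hm0 : 0 < m := by linarith
  set P : ℝ → ℝ := fun x => max 0 (min x r) with hP
  have hPI : ∀ x, P x ∈ Icc 0 r := fun x => ⟨le_max_left _ _, max_le hr (min_le_right _ _)⟩
  have hPmono : Monotone P := fun x y h => by simp only [hP]; gcongr
  have hPid : ∀ x ∈ Icc 0 r, P x = x := fun x hx => by
    simp [hP, hx.1, hx.2]
  have hPcont : Continuous P := by fun_prop
  have hPlip : ∀ x y, |P x - P y| ≤ |x - y| := fun x y => by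
    simp only [hP, max_comm (0 : ℝ)]
    exact (abs_max_sub_max_le_abs _ _ _).trans (abs_inf_sub_inf_le_abs x y r)
  set V : ℕ → ℝ → ℝ := fun k x => radialIterate m ψ b k (P x) with hV
  have hVcont : ∀ k, Continuous (V k) := fun k => (continuous_radialIterate hm hψ b k).comp hPcont
  have hVC : ∀ k x, V k x ≤ C := fun k x =>
    (radialIterate_mono_right hm hψ h0 b k (hPI x).1 (hPI x).2).trans (hC k)
  have hVk : ∀ x, Monotone fun k => V k x := fun x =>
    monotone_nat_of_le_succ fun k => radialIterate_le_succ hm hψ hmono h0 hb k _ (hPI x).1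
  have hbdd : ∀ x, BddAbove (range fun k => V k x) := fun x =>
    ⟨C, by rintro _ ⟨k, rfl⟩; exact hVC k x⟩
  set v : ℝ → ℝ := fun x => ⨆ k, V k x with hv
  have hlim : ∀ x, Tendsto (fun k => V k x) atTop (𝓝 (v x)) := fun x =>
    tendsto_atTop_ciSup (hVk x) (hbdd x)
  have hVv : ∀ k x, V k x ≤ v x := fun k x => le_ciSup (hbdd x) k
  set Λ : ℝ := r * ψ C / m with hΛ
  have hΛ0 : 0 ≤ Λ := div_nonneg (mul_nonneg hr (h0 C)) hm0.le
  have hstep : ∀ k x y, 0 ≤ x → x ≤ y → y ≤ r →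
      radialIterate m ψ b (k + 1) y ≤ radialIterate m ψ b (k + 1) x + Λ * (y - x) := by
    intro k x y hx hxy hy
    have hg : Continuous fun s => ψ (radialIterate m ψ b k s) :=
      hψ.comp (continuous_radialIterate hm hψ b k)
    have := le_of_hasDerivAt_nonneg (f := fun t => Λ * t - radialIterate m ψ b (k + 1) t)
      (f' := fun t => Λ * 1 - radialFlux m (fun s => ψ (radialIterate m ψ b k s)) t) hxy
      ((by fun_prop : Continuous fun t => Λ * t).sub
        (continuous_radialIterate hm hψ b (k + 1))).continuousOn
      (fun t _ => ((hasDerivAt_id t).const_mul Λ).sub (hasDerivAt_radialPotential hm b hg t))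
      (fun t ht => by
        have ht0 : 0 ≤ t := hx.trans ht.1.le
        have htr : t ≤ r := ht.2.le.trans hy
        have h1 := radialFlux_mono hm hg (continuous_const (y := ψ C)) ht0 (fun s hs =>
          hmono ((radialIterate_mono_right hm hψ h0 b k hs.1 (hs.2.trans htr)).trans (hC k)))
        rw [radialFlux_const hm] at h1
        have h2 : t * ψ C / m ≤ Λ := by
          have := h0 C
          rw [hΛ]; gcongr
        linarith)
    linarith
  have hlip : ∀ x y, v x ≤ v y + Λ * dist x y := by
    intro x y
    have h1 : ∀ k, V (k + 1) x ≤ V (k + 1) y + Λ * dist x y := by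
      intro k
      rcases le_total (P y) (P x) with h | h
      · refine (hstep k (P y) (P x) (hPI y).1 h (hPI x).2).trans ?_
        have := hPlip x y
        have h2 : P x - P y ≤ dist x y := (le_abs_self _).trans this
        have := mul_le_mul_of_nonneg_left h2 hΛ0
        simp only [hV]
        linarith
      · have h2 := radialIterate_mono_right hm hψ h0 b (k + 1) (hPI x).1 h
        have := mul_nonneg hΛ0 (dist_nonneg (x := x) (y := y))
        simp only [hV]
        linarith
    exact le_of_tendsto_of_tendsto' ((tendsto_add_atTop_iff_nat 1).2 (hlim x))
      (((tendsto_add_atTop_iff_nat 1).2 (hlim y)).add_const _) h1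
  have hvcont : Continuous v := (LipschitzWith.of_le_add_mul' Λ hlip).continuous
  refine ⟨v, hvcont, ?_, ?_, ?_, ?_⟩
  · intro x y hxy
    exact ciSup_mono (hbdd y) fun k =>
      radialIterate_mono_right hm hψ h0 b k (hPI x).1 (hPmono hxy)
  · exact fun x => (radialIterate_nonneg hm hψ h0 hb 0 (hPI x).1).trans (hVv 0 x)
  · intro x hx
    have h1 : Tendsto (fun k => radialPotential m b (fun s => ψ (V k s)) x) atTop
        (𝓝 (radialPotential m b (fun s => ψ (v s)) x)) := by
      refine tendsto_radialPotential hm b (c := ψ C) (fun k => hψ.comp (hVcont k)) ?_ ?_ x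
      · intro k s
        rw [Function.comp_apply, abs_of_nonneg (h0 _)]
        exact hmono (hVC k s)
      · exact fun s => (hψ.tendsto _).comp (hlim s)
    have h2 : ∀ k, V (k + 1) x = radialPotential m b (fun s => ψ (V k s)) x := by
      intro k
      simp only [hV]
      rw [hPid x hx]
      refine radialPotential_congr hm (hψ.comp (continuous_radialIterate hm hψ b k))
        (hψ.comp (hVcont k)) hx.1 fun s hs => ?_
      simp only [Function.comp, hV]
      rw [hPid s ⟨hs.1, hs.2.trans hx.2⟩]
    have h3 := (tendsto_add_atTop_iff_nat 1).2 (hlim x)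
    simp only [h2] at h3
    exact tendsto_nhds_unique h1 h3
  · intro k x hx
    have := hVv k x
    simp only [hV] at this
    rwa [hPid x hx] at this

/-- Boundedness of the iterates at `r` persists for slightly larger initial values. -/
lemma exists_gt_bounded_radialIterate {m : ℝ} (hm : 1 < m) {ψ : ℝ → ℝ} (hψ : Continuous ψ)
    (hmono : Monotone ψ) (h0 : ∀ t, 0 ≤ ψ t)
    (hlip : ∀ M : ℝ, ∃ K : ℝ, 0 ≤ K ∧ ∀ x y, 0 ≤ x → x ≤ y → y ≤ M → ψ y ≤ ψ x + K * (y - x))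
    {b r C : ℝ} (hb : 0 ≤ b) (hr : 0 ≤ r) (hC : ∀ k, radialIterate m ψ b k r ≤ C) :
    ∃ b', b < b' ∧ ∃ C', ∀ k, radialIterate m ψ b' k r ≤ C' := by
  obtain ⟨v, hvc, hvm, hv0, hfix, -⟩ := exists_radial_fixedPoint hm hψ hmono h0 hb hr hC
  obtain ⟨K, hK, hKlip⟩ := hlip (v r + 1)
  have hm0 : 0 < m := by linarith
  set l : ℝ := K + 1 with hl
  set ε : ℝ := Real.exp (-(l * r ^ 2)) with hε
  have hε0 : 0 < ε := Real.exp_pos _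
  have hg : Continuous fun s => ψ (v s) := hψ.comp hvc
  have key : ∀ k, ∀ x ∈ Icc 0 r,
      radialIterate m ψ (b + ε) k x ≤ v x + ε * Real.exp (l * x ^ 2) := by
    intro k
    induction k with
    | zero =>
      intro x _
      have := hv0 x
      simp only [radialIterate]
      positivity
    | succ k ih =>
      intro x hx
      have hgk : Continuous fun s => ψ (radialIterate m ψ (b + ε) k s) :=
        hψ.comp (continuous_radialIterate hm hψ _ k)
      have hexp : ∀ t : ℝ, HasDerivAt (fun t => ε * Real.exp (l * t ^ 2))
          (ε * (Real.exp (l * t ^ 2) * (l * ((2 : ℕ) * t ^ (2 - 1) * 1)))) t := fun t =>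
        ((((hasDerivAt_id t).pow 2).const_mul l).exp).const_mul ε
      have := le_of_hasDerivAt_nonneg
        (f := fun t => radialPotential m b (fun s => ψ (v s)) t + ε * Real.exp (l * t ^ 2) -
          radialPotential m (b + ε) (fun s => ψ (radialIterate m ψ (b + ε) k s)) t)
        (f' := fun t => radialFlux m (fun s => ψ (v s)) t +
          ε * (Real.exp (l * t ^ 2) * (l * ((2 : ℕ) * t ^ (2 - 1) * 1))) -
          radialFlux m (fun s => ψ (radialIterate m ψ (b + ε) k s)) t)
        hx.1
        (((continuous_radialPotential hm b hg).add (by fun_prop)).sub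
          (continuous_radialPotential hm _ hgk)).continuousOn
        (fun t _ => ((hasDerivAt_radialPotential hm b hg t).add (hexp t)).sub
          (hasDerivAt_radialPotential hm _ hgk t))
        (fun t ht => by
          have h1 := radialFlux_le_add_const hm hgk hg ht.1.le
            (c := K * (ε * Real.exp (l * t ^ 2))) (fun s hs => by
              have hsr : s ≤ r := hs.2.trans (ht.2.le.trans hx.2)
              have h2 := ih s ⟨hs.1, hsr⟩
              have h3 : ε * Real.exp (l * s ^ 2) ≤ 1 := by
                rw [hε, ← Real.exp_add, Real.exp_le_one_iff]
                have : s ^ 2 ≤ r ^ 2 := pow_le_pow_left₀ hs.1 hsr 2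
                nlinarith
              have h4 := hKlip (v s) (v s + ε * Real.exp (l * s ^ 2)) (hv0 s)
                (by linarith [mul_pos hε0 (Real.exp_pos (l * s ^ 2))])
                (by linarith [hvm hsr])
              have h5 : ε * Real.exp (l * s ^ 2) ≤ ε * Real.exp (l * t ^ 2) := by
                have : s ^ 2 ≤ t ^ 2 := pow_le_pow_left₀ hs.1 hs.2 2
                have hl0 : 0 ≤ l := by linarith
                gcongr
              have h6 := mul_le_mul_of_nonneg_left h5 hK
              have h7 := hmono h2
              rw [add_sub_cancel_left] at h4
              linarith)
          have h8 : t * (K * (ε * Real.exp (l * t ^ 2))) / m ≤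
              t * (K * (ε * Real.exp (l * t ^ 2))) :=
            div_le_self (by have := ht.1; positivity) hm.le
          have h9 : ε * (Real.exp (l * t ^ 2) * (l * ((2 : ℕ) * t ^ (2 - 1) * 1))) =
              t * (K * (ε * Real.exp (l * t ^ 2))) +
                (K + 2) * (t * (ε * Real.exp (l * t ^ 2))) := by
            rw [hl]; push_cast; ring
          have h10 : 0 ≤ (K + 2) * (t * (ε * Real.exp (l * t ^ 2))) := by
            have := ht.1; positivity
          linarith)
      simp only [radialPotential_zero] at this
      rw [hfix x hx] at this
      simp only [radialIterate]
      norm_num at this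
      linarith
  exact ⟨b + ε, by linarith, _, fun k => key k r ⟨hr, le_rfl⟩⟩

/-- Keller–Osserman bound for the iterates. -/
lemma exists_bound_radialIterate {m : ℝ} (hm : 1 < m) {ψ : ℝ → ℝ} (hψ : Continuous ψ)
    (hmono : Monotone ψ) (h0 : ∀ t, 0 ≤ ψ t)
    (hKO : ∃ a : ℝ, 0 < a ∧
      ∫⁻ t in Set.Ioi a, (ENNReal.ofReal (Real.sqrt (∫ s in (0:ℝ)..t, ψ s)))⁻¹ < ⊤)
    {ε : ℝ} (hε : 0 < ε) :
    ∃ A : ℝ, ∀ b x C, 0 ≤ b → 0 ≤ x → (∀ k, radialIterate m ψ b k (x + ε) ≤ C) →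
      ∀ k, radialIterate m ψ b k x ≤ A := by
  obtain ⟨A, hA⟩ := exists_bound_of_kellerOsserman hm hψ hmono h0 hKO hε
  refine ⟨A, fun b x C hb hx hC k => ?_⟩
  obtain ⟨v, hvc, hvm, hv0, hfix, hle⟩ :=
    exists_radial_fixedPoint hm hψ hmono h0 hb (by linarith : 0 ≤ x + ε) hC
  have hg : Continuous fun s => ψ (v s) := hψ.comp hvc
  have hxI : x ∈ Icc 0 (x + ε) := ⟨hx, by linarith⟩
  have := hA x (radialPotential m b fun s => ψ (v s)) (radialFlux m fun s => ψ (v s))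
    (radialFluxDeriv m fun s => ψ (v s)) (hasDerivAt_radialPotential hm b hg)
    (hasDerivAt_radialFlux hm hg) (radialFlux_nonneg hm hg hx fun s _ => h0 _)
    (fun y hy => by
      rw [hfix y ⟨hx.trans hy.1, hy.2⟩]
      exact div_le_radialFluxDeriv hm hg (hmono.comp hvm) (hx.trans hy.1))
  rw [hfix x hxI] at this
  exact (hle k x hxI).trans this.le

lemma isSolOn_radialPotential {m : ℝ} (hm : 1 < m) {φ ψ v : ℝ → ℝ} {b r : ℝ} (hψ : Continuous ψ)
    (hψφ : ∀ x, 0 ≤ x → ψ x = φ x) (hvc : Continuous v) (hv0 : ∀ x, 0 ≤ v x)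
    (hfix : ∀ x ∈ Icc 0 r, radialPotential m b (fun s => ψ (v s)) x = v x) :
    IsSolOn m φ b (ENNReal.ofReal r) (radialPotential m b fun s => ψ (v s)) := by
  have hg : Continuous fun s => ψ (v s) := hψ.comp hvc
  have hmem : ∀ x, 0 ≤ x → ENNReal.ofReal x < ENNReal.ofReal r → x ∈ Icc 0 r := fun x hx h =>
    ⟨hx, ((ENNReal.ofReal_lt_ofReal_iff_of_nonneg hx).1 h).le⟩
  refine ⟨(contDiff_radialPotential hm b hg).contDiffOn, fun x hx => ?_, by simp, ?_, ?_⟩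
  · rw [hfix x (hmem x hx.1 hx.2)]
    exact hv0 x
  · rw [(hasDerivAt_radialPotential hm b hg 0).hasDerivWithinAt.derivWithin
      (uniqueDiffOn_Ici 0 0 self_mem_Ici), radialFlux_zero]
  · intro x hx hxr
    have h1 : deriv (radialPotential m b fun s => ψ (v s)) = radialFlux m fun s => ψ (v s) :=
      funext fun y => (hasDerivAt_radialPotential hm b hg y).deriv
    rw [h1, (hasDerivAt_radialFlux hm hg x).deriv, radialFluxDeriv_eq _ hx.ne',
      hfix x (hmem x hx.le hxr), hψφ _ (hv0 x)]
    ring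

lemma odeDom_mem_nhds {R : ℝ≥0∞} {x : ℝ} (hx : 0 < x) (hxR : ENNReal.ofReal x < R) :
    odeDom R ∈ 𝓝 x := by
  have h1 : ∀ᶠ y in 𝓝 x, ENNReal.ofReal y < R :=
    ENNReal.continuous_ofReal.continuousAt.eventually_lt continuousAt_const hxR
  filter_upwards [h1, lt_mem_nhds hx] with y hy1 hy2
  exact ⟨hy2.le, hy1⟩

/-- The iterates lie below every solution. -/
lemma radialIterate_le_of_isSolOn {m : ℝ} (hm : 1 < m) {φ ψ u : ℝ → ℝ} {b : ℝ} {R : ℝ≥0∞}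
    (hψ : Continuous ψ) (hmono : Monotone ψ) (hψφ : ∀ x, 0 ≤ x → ψ x = φ x)
    (hu : IsSolOn m φ b R u) (k : ℕ) : ∀ x ∈ odeDom R, radialIterate m ψ b k x ≤ u x := by
  obtain ⟨hC2, hu0, hub, -, hode⟩ := hu
  induction k with
  | zero => exact hu0
  | succ k ih =>
    intro x hx
    rcases hx.1.eq_or_lt with rfl | hx0
    · rw [hub]; simp [radialIterate]
    set D := odeDom R with hD
    have hsub : Icc 0 x ⊆ D := fun y hy =>
      ⟨hy.1, (ENNReal.ofReal_le_ofReal hy.2).trans_lt hx.2⟩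
    have hnhds : ∀ y ∈ Ioo 0 x, D ∈ 𝓝 y := fun y hy =>
      odeDom_mem_nhds hy.1 (hsub ⟨hy.1.le, hy.2.le⟩).2
    have hconv : Convex ℝ D := by
      refine OrdConnected.convex ⟨fun y hy z hz w hw => ?_⟩
      exact ⟨hy.1.trans hw.1, (ENNReal.ofReal_le_ofReal hw.2).trans_lt hz.2⟩
    have huniq : UniqueDiffOn ℝ D := uniqueDiffOn_convex hconv
      ⟨x, mem_interior_iff_mem_nhds.2 (odeDom_mem_nhds hx0 hx.2)⟩
    have hg : Continuous fun s => ψ (radialIterate m ψ b k s) :=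
      hψ.comp (continuous_radialIterate hm hψ b k)
    set g : ℝ → ℝ := fun s => ψ (radialIterate m ψ b k s) with hgdef
    have huC1 : ContDiffOn ℝ 1 (derivWithin u D) D :=
      hC2.derivWithin huniq (by norm_num)
    have hdu : ∀ y ∈ Ioo 0 x, HasDerivAt u (derivWithin u D y) y := by
      intro y hy
      rw [derivWithin_of_mem_nhds (hnhds y hy)]
      exact ((hC2.contDiffAt (hnhds y hy)).differentiableAt (by norm_num)).hasDerivAt
    have hddu : ∀ y ∈ Ioo 0 x, HasDerivAt (derivWithin u D)
        (φ (u y) - (m - 1) / y * derivWithin u D y) y := by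
      intro y hy
      have hev : derivWithin u D =ᶠ[𝓝 y] deriv u := by
        filter_upwards [Ioo_mem_nhds hy.1 hy.2] with z hz
        exact derivWithin_of_mem_nhds (hnhds z hz)
      have h1 := ((huC1.contDiffAt (hnhds y hy)).differentiableAt (by norm_num)).hasDerivAt
      have h2 := hode y hy.1 (hsub ⟨hy.1.le, hy.2.le⟩).2
      rw [hev.deriv_eq] at h1
      refine h1.congr_deriv ?_
      rw [hev.eq_of_nhds]
      linarith
    have hdiff : ∀ y ∈ Ioo 0 x, 0 ≤ derivWithin u D y - radialFlux m g y := by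
      intro y hy
      have hsub' : Icc 0 y ⊆ D := (Icc_subset_Icc_right hy.2.le).trans hsub
      have := le_of_hasDerivAt_nonneg
        (f := fun t => t ^ (m - 1) * (derivWithin u D t - radialFlux m g t))
        (f' := fun t => (m - 1) * t ^ (m - 1 - 1) * (derivWithin u D t - radialFlux m g t) +
          t ^ (m - 1) * ((φ (u t) - (m - 1) / t * derivWithin u D t) - radialFluxDeriv m g t))
        hy.1.le
        ((continuous_rpow_sub_one hm).continuousOn.mul ((huC1.continuousOn.mono hsub').sub
          (continuous_radialFlux hm hg).continuousOn))
        (fun t ht => (Real.hasDerivAt_rpow_const (Or.inl ht.1.ne')).mul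
          ((hddu t ⟨ht.1, ht.2.trans hy.2⟩).sub (hasDerivAt_radialFlux hm hg t)))
        (fun t ht => by
          have htD := hsub' ⟨ht.1.le, ht.2.le⟩
          have h1 : g t ≤ φ (u t) := by
            rw [← hψφ _ (hu0 t htD)]
            exact hmono (ih t htD)
          rw [radialFluxDeriv_eq _ ht.1.ne', Real.rpow_sub_one ht.1.ne']
          have h2 : 0 ≤ t ^ (m - 1) * (φ (u t) - g t) :=
            mul_nonneg (Real.rpow_nonneg ht.1.le _) (by linarith)
          refine h2.trans_eq ?_
          ring)
      rw [Real.zero_rpow (by linarith), zero_mul] at this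
      exact nonneg_of_mul_nonneg_right this (Real.rpow_pos_of_pos hy.1 _)
    have := le_of_hasDerivAt_nonneg (f := fun t => u t - radialPotential m b g t)
      (f' := fun t => derivWithin u D t - radialFlux m g t) hx0.le
      ((hC2.continuousOn.mono hsub).sub (continuous_radialPotential hm b hg).continuousOn)
      (fun t ht => (hdu t ht).sub (hasDerivAt_radialPotential hm b hg t)) hdiff
    rw [hub, radialPotential_zero, sub_self] at this
    simp only [radialIterate]
    linarith

lemma radialIterate_zero_left (m : ℝ) {ψ : ℝ → ℝ} (hψ0 : ψ 0 = 0) (k : ℕ) :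
    radialIterate m ψ 0 k = fun _ => 0 := by
  induction k with
  | zero => rfl
  | succ k ih =>
    funext x
    simp [radialIterate, ih, hψ0, radialPotential, radialFlux]

/-- under the finiteness condition, every positive radius is attained as a
maximal existence radius. -/
theorem maxRadius_surjective
    (m : ℝ) (hm : 2 < m)
    (φ : ℝ → ℝ) (hφ0 : φ 0 = 0)
    (hφmono : MonotoneOn φ (Set.Ici 0))
    (hφnonneg : ∀ t : ℝ, 0 ≤ t → 0 ≤ φ t)
    (hφlip : ∀ x ∈ Set.Ici (0 : ℝ), ∃ K : NNReal, ∃ s ∈ nhdsWithin x (Set.Ici 0),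
      LipschitzOnWith K φ s)
    (hKO : ∃ a : ℝ, 0 < a ∧
      ∫⁻ t in Set.Ioi a, (ENNReal.ofReal (Real.sqrt (∫ s in (0:ℝ)..t, φ s)))⁻¹ < ⊤) :
    ∀ r : ℝ, 0 < r → ∃ b : ℝ, 0 < b ∧ maxRadius m φ b = ENNReal.ofReal r := by
  intro r hr
  have hm1 : 1 < m := by linarith
  set ψ : ℝ → ℝ := fun x => φ (max x 0) with hψdef
  have hψφ : ∀ x, 0 ≤ x → ψ x = φ x := fun x hx => by simp [hψdef, hx]
  have hloc : LocallyLipschitzOn (Ici 0) φ := fun x hx => hφlip x hx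
  have hψ : Continuous ψ :=
    hloc.continuousOn.comp_continuous (by fun_prop) fun x => le_max_right x 0
  have hmono : Monotone ψ := fun x y h =>
    hφmono (le_max_right x 0) (le_max_right y 0) (max_le_max_right 0 h)
  have h0 : ∀ t, 0 ≤ ψ t := fun t => hφnonneg _ (le_max_right t 0)
  have hψ0 : ψ 0 = 0 := by simp [hψdef, hφ0]
  have hlip : ∀ M : ℝ, ∃ K : ℝ, 0 ≤ K ∧
      ∀ x y, 0 ≤ x → x ≤ y → y ≤ M → ψ y ≤ ψ x + K * (y - x) := by
    intro M
    obtain ⟨K, hK⟩ := (hloc.mono (Icc_subset_Ici_self : Icc 0 M ⊆ Ici 0)).exists_lipschitzOnWith_of_compact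
      isCompact_Icc
    refine ⟨K, K.2, fun x y hx hxy hy => ?_⟩
    have := hK.le_add_mul (x := y) (y := x) ⟨hx.trans hxy, hy⟩ ⟨hx, hxy.trans hy⟩
    rwa [Real.dist_eq, abs_of_nonneg (sub_nonneg.2 hxy), ← hψφ x hx,
      ← hψφ y (hx.trans hxy)] at this
  have hKO' : ∃ a : ℝ, 0 < a ∧
      ∫⁻ t in Set.Ioi a, (ENNReal.ofReal (Real.sqrt (∫ s in (0:ℝ)..t, ψ s)))⁻¹ < ⊤ := by
    obtain ⟨a, ha, h⟩ := hKO
    refine ⟨a, ha, ?_⟩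
    rw [setLIntegral_congr_fun measurableSet_Ioi (g := fun t =>
      (ENNReal.ofReal (Real.sqrt (∫ s in (0:ℝ)..t, φ s)))⁻¹)]
    · exact h
    · intro t ht
      have : ∫ s in (0:ℝ)..t, ψ s = ∫ s in (0:ℝ)..t, φ s := by
        apply intervalIntegral.integral_congr
        intro s hs
        rw [uIcc_of_le (ha.trans ht).le] at hs
        exact hψφ s hs.1
      simp only [this]
  set S : Set ℝ := {b | 0 ≤ b ∧ ∃ ρ, r < ρ ∧ ∃ C, ∀ k, radialIterate m ψ b k ρ ≤ C} with hS
  have h0S : (0 : ℝ) ∈ S := ⟨le_rfl, r + 1, by linarith, 0, fun k => by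
    rw [radialIterate_zero_left m hψ0]⟩
  have hbelow : ∀ b ∈ S, ∃ C, ∀ k, radialIterate m ψ b k r ≤ C := by
    rintro b ⟨-, ρ, hρ, C, hC⟩
    exact ⟨C, fun k => (radialIterate_mono_right hm1 hψ h0 b k hr.le hρ.le).trans (hC k)⟩
  have hSbdd : BddAbove S := by
    obtain ⟨A, hA⟩ := exists_bound_radialIterate hm1 hψ hmono h0 hKO' hr
    refine ⟨A, fun b hb => ?_⟩
    obtain ⟨C, hC⟩ := hbelow b hb
    have := hA b 0 C hb.1 le_rfl (by simpa using hC) 1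
    simpa [radialIterate] using this
  have hSopen : ∀ b ∈ S, ∃ b' ∈ S, b < b' := by
    rintro b ⟨hb, ρ, hρ, C, hC⟩
    obtain ⟨b', hbb', C', hC'⟩ :=
      exists_gt_bounded_radialIterate hm1 hψ hmono h0 hlip hb (hr.trans hρ).le hC
    exact ⟨b', ⟨hb.trans hbb'.le, ρ, hρ, C', hC'⟩, hbb'⟩
  set β := sSup S with hβ
  have hβS : β ∉ S := fun h => by
    obtain ⟨b', hb', hlt⟩ := hSopen β h
    exact (le_csSup hSbdd hb').not_gt hlt
  have hβ0 : 0 < β := by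
    obtain ⟨b', hb', hlt⟩ := hSopen 0 h0S
    exact hlt.trans_le (le_csSup hSbdd hb')
  refine ⟨β, hβ0, le_antisymm (sSup_le ?_) (le_of_forall_lt fun c hc => ?_)⟩
  · rintro R ⟨-, u, hu⟩
    by_contra hlt
    push Not at hlt
    obtain ⟨ρ, hρ0, hrρ, hρR⟩ := ENNReal.lt_iff_exists_real_btwn.1 hlt
    refine hβS ⟨hβ0.le, ρ, (ENNReal.ofReal_lt_ofReal_iff_of_nonneg hr.le).1 hrρ, u ρ, fun k => ?_⟩
    exact radialIterate_le_of_isSolOn hm1 hψ hmono hψφ hu k ρ ⟨hρ0, hρR⟩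
  · obtain ⟨x, hx0, hcx, hxr⟩ := ENNReal.lt_iff_exists_real_btwn.1 hc
    have hxr' : x < r := (ENNReal.ofReal_lt_ofReal_iff_of_nonneg hx0).1 hxr
    refine hcx.trans_le (le_sSup ⟨bot_le.trans_lt hcx, ?_⟩)
    obtain ⟨A, hA⟩ := exists_bound_radialIterate hm1 hψ hmono h0 hKO' (sub_pos.2 hxr')
    have hlt : ∀ b < β, ∀ k, radialIterate m ψ b k x ≤ A := by
      intro b hb k
      obtain ⟨c, hcS, hbc⟩ := exists_lt_of_lt_csSup ⟨0, h0S⟩ hb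
      obtain ⟨C, hC⟩ := hbelow c hcS
      exact (radialIterate_mono_left hm1 hψ hmono hbc.le k x hx0).trans
        (hA c x C hcS.1 hx0 (by simpa using hC) k)
    have hbound : ∀ k, radialIterate m ψ β k x ≤ A := by
      intro k
      have hcont : Continuous fun b => radialIterate m ψ b k x :=
        (continuous_radialIterate_uncurry hm1 hψ k).comp
          (by fun_prop : Continuous fun b : ℝ => (b, x))
      refine le_of_tendsto (hcont.continuousWithinAt (s := Iio β) (x := β)) ?_
      filter_upwards [self_mem_nhdsWithin] with b hb
      exact hlt b hb k
    obtain ⟨v, hvc, -, hv0, hfix, -⟩ :=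
      exists_radial_fixedPoint hm1 hψ hmono h0 hβ0.le hx0 hbound
    exact ⟨_, isSolOn_radialPotential hm1 hψ hψφ hvc hv0 hfix⟩
end
end

section
/- Assume there exists a constant a > 0 such that ∫_a^∞ dt/√(∫_0^t φ(s) ds) < ∞ (with the convention that the integrand equals +∞ where ∫_0^t φ(s) ds = 0). Then lim_{ρ→∞} R_ρ = 0. -/
open MeasureTheory Real Filter Set
open scoped ENNReal Topology

noncomputable section

lemma monotoneOn_Icc_of_hasDerivAt_nonneg {f f' : ℝ → ℝ} {a b : ℝ}
    (hc : ContinuousOn f (Icc a b)) (hd : ∀ x ∈ Ioo a b, HasDerivAt f (f' x) x)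
    (hn : ∀ x ∈ Ioo a b, 0 ≤ f' x) : MonotoneOn f (Icc a b) := by
  refine monotoneOn_of_hasDerivWithinAt_nonneg (f' := f') (convex_Icc a b) hc ?_ ?_
  · rw [interior_Icc]
    exact fun x hx => (hd x hx).hasDerivWithinAt
  · rwa [interior_Icc]

lemma intervalIntegrable_of_continuousOn_Ici {φ : ℝ → ℝ} (hφc : ContinuousOn φ (Ici 0))
    {s t : ℝ} (hs : 0 ≤ s) (ht : 0 ≤ t) : IntervalIntegrable φ volume s t :=
  (hφc.mono fun _ hx => (le_inf hs ht).trans hx.1).intervalIntegrable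

lemma hasDerivAt_primitive {φ : ℝ → ℝ} (hφc : ContinuousOn φ (Ici 0)) {t : ℝ} (ht : 0 < t) :
    HasDerivAt (fun t => ∫ s in (0 : ℝ)..t, φ s) (φ t) t :=
  intervalIntegral.integral_hasDerivAt_right
    (intervalIntegrable_of_continuousOn_Ici hφc le_rfl ht.le)
    ((hφc.mono Ioi_subset_Ici_self).stronglyMeasurableAtFilter isOpen_Ioi t ht)
    (hφc.continuousAt (Ici_mem_nhds ht))

lemma mul_sub_le_primitive_sub {φ : ℝ → ℝ} (hφc : ContinuousOn φ (Ici 0))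
    (hφmono : MonotoneOn φ (Ici 0)) {s t : ℝ} (hs : 0 ≤ s) (hst : s ≤ t) :
    φ s * (t - s) ≤ (∫ x in (0 : ℝ)..t, φ x) - ∫ x in (0 : ℝ)..s, φ x := by
  rw [intervalIntegral.integral_interval_sub_left
    (intervalIntegrable_of_continuousOn_Ici hφc le_rfl (hs.trans hst))
    (intervalIntegrable_of_continuousOn_Ici hφc le_rfl hs)]
  have h := intervalIntegral.integral_mono_on hst (intervalIntegrable_const (c := φ s))
    (intervalIntegrable_of_continuousOn_Ici hφc hs (hs.trans hst))
    fun x hx => hφmono hs (hs.trans hx.1) hx.1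
  rw [intervalIntegral.integral_const, smul_eq_mul] at h
  linarith

lemma primitive_le_mul {φ : ℝ → ℝ} (hφc : ContinuousOn φ (Ici 0))
    (hφmono : MonotoneOn φ (Ici 0)) {t : ℝ} (ht : 0 ≤ t) :
    (∫ x in (0 : ℝ)..t, φ x) ≤ t * φ t := by
  have h := intervalIntegral.integral_mono_on ht
    (intervalIntegrable_of_continuousOn_Ici hφc le_rfl ht)
    (intervalIntegrable_const (c := φ t))
    fun x hx => hφmono hx.1 ht hx.2
  rw [intervalIntegral.integral_const, smul_eq_mul] at h
  linarith

/-- An antiderivative of `1 / √F`, with a finite limit at infinity. -/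
lemma exists_antiderivative_inv_sqrt {F : ℝ → ℝ} {a : ℝ} (hFc : ContinuousOn F (Ioi a))
    (hFm : MonotoneOn F (Ioi a))
    (hfin : ∫⁻ t in Ioi a, (ENNReal.ofReal (√(F t)))⁻¹ < ⊤) :
    (∀ t, a < t → 0 < F t) ∧
    ∃ (H : ℝ → ℝ) (L : ℝ), (∀ t, a < t → HasDerivAt H (√(F t))⁻¹ t) ∧
      Tendsto H atTop (𝓝 L) := by
  have hpos : ∀ t, a < t → 0 < F t := by
    intro t ht
    by_contra! hF
    have h1 : ∫⁻ _ in Ioo a t, (⊤ : ℝ≥0∞) ≤ ∫⁻ t in Ioi a, (ENNReal.ofReal (√(F t)))⁻¹ := by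
      refine le_trans (le_of_eq ?_) (lintegral_mono_set (Ioo_subset_Ioi_self : Ioo a t ⊆ _))
      refine setLIntegral_congr_fun measurableSet_Ioo fun s hs => ?_
      have : F s ≤ 0 := (hFm hs.1 ht hs.2.le).trans hF
      simp [Real.sqrt_eq_zero_of_nonpos this]
    have h2 : ∫⁻ _ in Ioo a t, (⊤ : ℝ≥0∞) = ⊤ := by
      rw [setLIntegral_const, Real.volume_Ioo, ENNReal.top_mul]
      simpa using ht
    exact absurd (h2 ▸ h1) (not_le.2 hfin)
  have hc : ContinuousOn (fun t => (√(F t))⁻¹) (Ioi a) :=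
    hFc.sqrt.inv₀ fun t ht => (Real.sqrt_pos.2 (hpos t ht)).ne'
  have hint : IntegrableOn (fun t => (√(F t))⁻¹) (Ioi a) := by
    refine ⟨hc.aestronglyMeasurable measurableSet_Ioi, ?_⟩
    refine lt_of_eq_of_lt (setLIntegral_congr_fun measurableSet_Ioi fun t ht => ?_) hfin
    have h := Real.sqrt_pos.2 (hpos t ht)
    rw [Real.enorm_of_nonneg (inv_nonneg.2 h.le), ENNReal.ofReal_inv_of_pos h]
  refine ⟨hpos, fun x => ∫ t in (a + 1)..x, (√(F t))⁻¹, _, fun t ht => ?_,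
    intervalIntegral_tendsto_integral_Ioi (a + 1)
      (hint.mono_set (Ioi_subset_Ioi (by linarith))) tendsto_id⟩
  refine intervalIntegral.integral_hasDerivAt_right ?_
    (hc.stronglyMeasurableAtFilter isOpen_Ioi t ht) (hc.continuousAt (Ioi_mem_nhds ht))
  refine (hc.mono fun x hx => ?_).intervalIntegrable
  exact (lt_inf_iff.2 ⟨by linarith, ht⟩ : a < (a + 1) ⊓ t).trans_le hx.1

/-- Under the Keller-Osserman condition, `φ` grows superlinearly. -/
lemma eventually_mul_le_of_antiderivative {φ F H : ℝ → ℝ} {a L : ℝ} (ha : 0 ≤ a)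
    (hFm : MonotoneOn F (Ioi a)) (hpos : ∀ t, a < t → 0 < F t)
    (hFle : ∀ t, a < t → F t ≤ t * φ t)
    (hH : ∀ t, a < t → HasDerivAt H (√(F t))⁻¹ t) (hL : Tendsto H atTop (𝓝 L))
    {C : ℝ} (hC : 0 < C) : ∀ᶠ t in atTop, C * t ≤ φ t := by
  have hhalf : Tendsto (fun t : ℝ => H t - H (t / 2)) atTop (𝓝 0) := by
    have := hL.sub (hL.comp (tendsto_id.atTop_div_const (two_pos : (0 : ℝ) < 2)))
    simpa using this
  have hδ : 0 < (2 * √C)⁻¹ := by positivity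
  filter_upwards [hhalf.eventually (gt_mem_nhds hδ), eventually_gt_atTop (2 * a),
    eventually_gt_atTop 0] with t ht hta ht0
  have hat : a < t := by linarith
  have hmono : MonotoneOn (fun x => H x - (√(F t))⁻¹ * x) (Icc (t / 2) t) := by
    refine monotoneOn_Icc_of_hasDerivAt_nonneg (f' := fun x => (√(F x))⁻¹ - (√(F t))⁻¹) ?_ ?_ ?_
    · intro x hx
      exact ((hH x (by linarith [hx.1])).continuousAt.sub
        (continuousAt_const.mul continuousAt_id)).continuousWithinAt
    · intro x hx
      have hax : a < x := by linarith [hx.1]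
      have h := (hH x hax).sub ((hasDerivAt_id x).const_mul (√(F t))⁻¹)
      rwa [mul_one] at h
    · intro x hx
      have hax : a < x := by linarith [hx.1]
      have := Real.sqrt_pos.2 (hpos x hax)
      exact sub_nonneg.2 (inv_anti₀ this (Real.sqrt_le_sqrt (hFm hax hat hx.2.le)))
  have h1 := hmono (left_mem_Icc.2 (by linarith)) (right_mem_Icc.2 (by linarith))
    (by linarith : t / 2 ≤ t)
  have hs := Real.sqrt_pos.2 (hpos t hat)
  have hsC := Real.sqrt_pos.2 hC
  have h2 : (√(F t))⁻¹ * (t / 2) < (2 * √C)⁻¹ := by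
    simp only at h1
    linarith
  have h3 : √C * t < √(F t) := by
    rw [inv_mul_eq_div, ← one_div, div_lt_div_iff₀ hs (by positivity)] at h2
    linarith
  have h4 : C * t * t < F t := by
    have := mul_self_lt_mul_self (by positivity) h3
    rw [Real.mul_self_sqrt (hpos t hat).le] at this
    nlinarith [Real.mul_self_sqrt hC.le]
  nlinarith [hFle t hat]

/-- The regularity of a solution on `[0, R)` restricted to a compact interval `[0, e]`. -/
lemma IsSolOn.exists_deriv {m : ℝ} {φ : ℝ → ℝ} {ρ : ℝ} {R : ℝ≥0∞} {u : ℝ → ℝ}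
    (h : IsSolOn m φ ρ R u) {e : ℝ} (he : 0 < e) (heR : ENNReal.ofReal e < R) :
    ∃ v : ℝ → ℝ, ContinuousOn u (Icc 0 e) ∧ ContinuousOn v (Icc 0 e) ∧ v 0 = 0 ∧
      (∀ r ∈ Ioo 0 e, HasDerivAt u (v r) r) ∧
      ∀ r ∈ Ioo 0 e, HasDerivAt v (φ (u r) - (m - 1) / r * v r) r := by
  obtain ⟨hC, -, -, hd0, hode⟩ := h
  have hsub : Icc 0 e ⊆ odeDom R := fun r hr =>
    ⟨hr.1, (ENNReal.ofReal_le_ofReal hr.2).trans_lt heR⟩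
  have hnhds : ∀ r ∈ Ioo 0 e, odeDom R ∈ 𝓝 r := fun r hr =>
    mem_of_superset (Icc_mem_nhds hr.1 hr.2) hsub
  have hconv : Convex ℝ (odeDom R) := by
    refine Set.OrdConnected.convex ⟨fun x hx y hy z hz => ?_⟩
    exact ⟨hx.1.trans hz.1, (ENNReal.ofReal_le_ofReal hz.2).trans_lt hy.2⟩
  have huniq : UniqueDiffOn ℝ (odeDom R) :=
    uniqueDiffOn_convex hconv ⟨e / 2, mem_interior_iff_mem_nhds.2
      (hnhds _ ⟨by linarith, by linarith⟩)⟩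
  have hv1 : ContDiffOn ℝ 1 (derivWithin u (odeDom R)) (odeDom R) :=
    hC.derivWithin huniq (by norm_num)
  have hderiv : ∀ r ∈ Ioo 0 e, derivWithin u (odeDom R) r = deriv u r := fun r hr =>
    derivWithin_of_mem_nhds (hnhds r hr)
  refine ⟨derivWithin u (odeDom R), hC.continuousOn.mono hsub, hv1.continuousOn.mono hsub,
    ?_, fun r hr => ?_, fun r hr => ?_⟩
  · refine (derivWithin_congr_set ?_).trans hd0
    filter_upwards [Iio_mem_nhds he] with r hr
    exact propext ⟨fun h => h.1, fun h => hsub ⟨h, (mem_Iio.1 hr).le⟩⟩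
  · rw [hderiv r hr]
    exact ((hC.contDiffAt (hnhds r hr)).differentiableAt (by norm_num)).hasDerivAt
  · have h1 : HasDerivAt (derivWithin u (odeDom R)) (deriv (derivWithin u (odeDom R)) r) r :=
      ((hv1.contDiffAt (hnhds r hr)).differentiableAt (by norm_num)).hasDerivAt
    have h2 : deriv (derivWithin u (odeDom R)) r = deriv (deriv u) r :=
      Filter.EventuallyEq.deriv_eq (by
        filter_upwards [Ioo_mem_nhds hr.1 hr.2] with s hs using hderiv s hs)
    convert h1 using 1
    rw [h2, hderiv r hr]
    linarith [hode r hr.1 ((ENNReal.ofReal_le_ofReal hr.2.le).trans_lt heR)]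

/-- A priori bounds for a radial solution `u` with derivative `v` on `[0, e]`. -/
lemma radial_solution_bounds {m : ℝ} (hm : 2 < m) {φ : ℝ → ℝ} (hφmono : MonotoneOn φ (Ici 0))
    (hφnonneg : ∀ t : ℝ, 0 ≤ t → 0 ≤ φ t) {F : ℝ → ℝ}
    (hF : ∀ t, 0 < t → HasDerivAt F (φ t) t) {ρ e : ℝ} (hρ : 0 < ρ) {u v : ℝ → ℝ}
    (hu0 : u 0 = ρ) (hv0 : v 0 = 0)
    (hunn : ∀ r ∈ Icc 0 e, 0 ≤ u r)
    (huc : ContinuousOn u (Icc 0 e)) (hvc : ContinuousOn v (Icc 0 e))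
    (hu : ∀ r ∈ Ioo 0 e, HasDerivAt u (v r) r)
    (hv : ∀ r ∈ Ioo 0 e, HasDerivAt v (φ (u r) - (m - 1) / r * v r) r) :
    MonotoneOn u (Icc 0 e) ∧ ∀ r ∈ Icc 0 e, 0 ≤ v r ∧ ρ + φ ρ * r ^ 2 / (2 * m) ≤ u r ∧
      2 / m * (F (u r) - F ρ) ≤ v r ^ 2 := by
  have hpc : ContinuousOn (fun r : ℝ => r ^ (m - 1)) (Icc 0 e) :=
    (Real.continuous_rpow_const (by linarith)).continuousOn
  have hz : (0 : ℝ) ^ (m - 1) = 0 := Real.zero_rpow (by linarith)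
  have hwd : ∀ r ∈ Ioo 0 e,
      HasDerivAt (fun r => r ^ (m - 1) * v r) (r ^ (m - 1) * φ (u r)) r := by
    intro r hr
    have h := ((hasDerivAt_id r).rpow_const (p := m - 1) (Or.inl hr.1.ne')).mul (hv r hr)
    refine h.congr_deriv ?_
    have : r ^ (m - 1) = r ^ (m - 1 - 1) * r := by
      rw [← Real.rpow_add_one hr.1.ne']; congr 1; ring
    have hr0 := hr.1.ne'
    simp only [id]
    rw [this]
    field_simp
    ring
  have hwm : MonotoneOn (fun r => r ^ (m - 1) * v r) (Icc 0 e) :=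
    monotoneOn_Icc_of_hasDerivAt_nonneg (hpc.mul hvc) hwd fun r hr =>
      mul_nonneg (Real.rpow_nonneg hr.1.le _) (hφnonneg _ (hunn r (Ioo_subset_Icc_self hr)))
  have hvnn : ∀ r ∈ Icc 0 e, 0 ≤ v r := by
    intro r hr
    rcases hr.1.eq_or_lt with rfl | hr0
    · exact hv0.ge
    have h := hwm (left_mem_Icc.2 (hr.1.trans hr.2)) hr hr.1
    simp only [hz, zero_mul] at h
    exact nonneg_of_mul_nonneg_right h (Real.rpow_pos_of_pos hr0 _)
  have hum : MonotoneOn u (Icc 0 e) :=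
    monotoneOn_Icc_of_hasDerivAt_nonneg huc hu fun r hr => hvnn r (Ioo_subset_Icc_self hr)
  have hρu : ∀ r ∈ Icc 0 e, ρ ≤ u r := fun r hr =>
    hu0 ▸ hum (left_mem_Icc.2 (hr.1.trans hr.2)) hr hr.1
  have hvle : ∀ r ∈ Ioo 0 e, v r ≤ φ (u r) / m * r := by
    intro r hr
    have hss : Icc 0 r ⊆ Icc 0 e := Icc_subset_Icc_right hr.2.le
    have hmon : MonotoneOn (fun s => φ (u r) / m * s ^ m - s ^ (m - 1) * v s) (Icc 0 r) := by
      refine monotoneOn_Icc_of_hasDerivAt_nonneg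
        (f' := fun s => s ^ (m - 1) * (φ (u r) - φ (u s))) ?_ ?_ ?_
      · exact (continuousOn_const.mul
          (Real.continuous_rpow_const (by linarith)).continuousOn).sub
          ((hpc.mul hvc).mono hss)
      · intro s hs
        have h := (((hasDerivAt_id s).rpow_const (p := m) (Or.inl hs.1.ne')).const_mul
          (φ (u r) / m)).sub (hwd s ⟨hs.1, hs.2.trans hr.2⟩)
        refine h.congr_deriv ?_
        have : m ≠ 0 := by linarith
        simp only [id]
        field_simp
      · intro s hs
        have hse := hss (Ioo_subset_Icc_self hs)
        have hre := Ioo_subset_Icc_self hr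
        exact mul_nonneg (Real.rpow_nonneg hs.1.le _) (sub_nonneg.2
          (hφmono (hunn s hse) (hunn r hre) (hum hse hre hs.2.le)))
    have h := hmon (left_mem_Icc.2 hr.1.le) (right_mem_Icc.2 hr.1.le) hr.1.le
    simp only [hz, zero_mul, Real.zero_rpow (by linarith : m ≠ 0), mul_zero, sub_zero] at h
    have h2 : r ^ m = r ^ (m - 1) * r := by
      rw [← Real.rpow_add_one hr.1.ne']; congr 1; ring
    rw [h2] at h
    have h3 : r ^ (m - 1) * v r ≤ r ^ (m - 1) * (φ (u r) / m * r) := by linarith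
    exact le_of_mul_le_mul_left h3 (Real.rpow_pos_of_pos hr.1 _)
  have hm0 : 0 < m := by linarith
  have hv' : ∀ r ∈ Ioo 0 e, φ (u r) / m ≤ φ (u r) - (m - 1) / r * v r := by
    intro r hr
    have h1 : (m - 1) / r * v r ≤ (m - 1) / r * (φ (u r) / m * r) :=
      mul_le_mul_of_nonneg_left (hvle r hr) (div_nonneg (by linarith) hr.1.le)
    have h2 : (m - 1) / r * (φ (u r) / m * r) = φ (u r) - φ (u r) / m := by
      have := hr.1.ne'
      field_simp
    linarith
  have hvlin : ∀ r ∈ Icc 0 e, φ ρ / m * r ≤ v r := by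
    intro r hr
    have hmon : MonotoneOn (fun s => v s - φ ρ / m * s) (Icc 0 e) := by
      refine monotoneOn_Icc_of_hasDerivAt_nonneg
        (hvc.sub (continuousOn_const.mul continuousOn_id))
        (fun s hs => (hv s hs).sub ((hasDerivAt_id s).const_mul (φ ρ / m))) fun s hs => ?_
      have hse := Ioo_subset_Icc_self hs
      have : φ ρ / m ≤ φ (u s) / m :=
        div_le_div_of_nonneg_right (hφmono hρ.le (hunn s hse) (hρu s hse)) hm0.le
      linarith [hv' s hs]
    have h := hmon (left_mem_Icc.2 (hr.1.trans hr.2)) hr hr.1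
    simp only [hv0, mul_zero] at h
    linarith
  refine ⟨hum, fun r hr => ⟨hvnn r hr, ?_, ?_⟩⟩
  · have hmon : MonotoneOn (fun s => u s - φ ρ / (2 * m) * s ^ 2) (Icc 0 e) := by
      refine monotoneOn_Icc_of_hasDerivAt_nonneg
        (huc.sub (continuousOn_const.mul (continuousOn_pow 2)))
        (fun s hs => (hu s hs).sub ((hasDerivAt_pow 2 s).const_mul (φ ρ / (2 * m))))
        fun s hs => ?_
      have h1 := hvlin s (Ioo_subset_Icc_self hs)
      have h2 : φ ρ / (2 * m) * (2 * s) = φ ρ / m * s := by field_simp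
      simp only [Nat.cast_ofNat, Nat.add_one_sub_one, pow_one]
      linarith
    have h := hmon (left_mem_Icc.2 (hr.1.trans hr.2)) hr hr.1
    simp only [hu0] at h
    have h2 : φ ρ * r ^ 2 / (2 * m) = φ ρ / (2 * m) * r ^ 2 := by ring
    rw [h2]
    linarith
  · have hupos : ∀ s ∈ Icc 0 e, 0 < u s := fun s hs => hρ.trans_le (hρu s hs)
    have hmon : MonotoneOn (fun s => v s ^ 2 - 2 / m * F (u s)) (Icc 0 e) := by
      refine monotoneOn_Icc_of_hasDerivAt_nonneg
        ((hvc.pow 2).sub (continuousOn_const.mul fun s hs =>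
          (hF _ (hupos s hs)).continuousAt.comp_continuousWithinAt (huc s hs)))
        (fun s hs => ((hv s hs).pow 2).sub
          (((hF _ (hupos s (Ioo_subset_Icc_self hs))).comp s (hu s hs)).const_mul (2 / m)))
        fun s hs => ?_
      have h1 := mul_le_mul_of_nonneg_left (hv' s hs) (hvnn s (Ioo_subset_Icc_self hs))
      have h2 : 2 / m * (φ (u s) * v s) = 2 * (v s * (φ (u s) / m)) := by ring
      simp only [Nat.cast_ofNat, Nat.add_one_sub_one, pow_one]
      linarith
    have h := hmon (left_mem_Icc.2 (hr.1.trans hr.2)) hr hr.1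
    simp only [hu0, hv0] at h
    linarith

/-- under the finiteness condition, the maximal existence radius tends to 0
as the initial value tends to ∞. -/
theorem maxRadius_tendsto_zero
    (m : ℝ) (hm : 2 < m)
    (φ : ℝ → ℝ) (hφ0 : φ 0 = 0)
    (hφmono : MonotoneOn φ (Set.Ici 0))
    (hφnonneg : ∀ t : ℝ, 0 ≤ t → 0 ≤ φ t)
    (hφlip : ∀ x ∈ Set.Ici (0 : ℝ), ∃ K : NNReal, ∃ s ∈ nhdsWithin x (Set.Ici 0),
      LipschitzOnWith K φ s)
    (hKO : ∃ a : ℝ, 0 < a ∧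
      ∫⁻ t in Set.Ioi a, (ENNReal.ofReal (Real.sqrt (∫ s in (0:ℝ)..t, φ s)))⁻¹ < ⊤) :
    Tendsto (fun ρ : ℝ => maxRadius m φ ρ) atTop (nhds 0) := by
  obtain ⟨a, ha, hfin⟩ := hKO
  have hφc : ContinuousOn φ (Ici 0) := fun x hx => by
    obtain ⟨K, s, hs, hK⟩ := hφlip x hx
    exact (hK.continuousOn x (mem_of_mem_nhdsWithin hx hs)).mono_of_mem_nhdsWithin hs
  obtain ⟨F, hFdef⟩ : ∃ F : ℝ → ℝ, ∀ t, F t = ∫ s in (0 : ℝ)..t, φ s := ⟨_, fun _ => rfl⟩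
  have hFd : ∀ t, 0 < t → HasDerivAt F (φ t) t := fun t ht =>
    funext hFdef ▸ hasDerivAt_primitive hφc ht
  have hFle : ∀ t, 0 ≤ t → F t ≤ t * φ t := fun t ht =>
    hFdef t ▸ primitive_le_mul hφc hφmono ht
  have hFsub : ∀ s t, 0 ≤ s → s ≤ t → φ s * (t - s) ≤ F t - F s := fun s t hs hst => by
    rw [hFdef, hFdef]
    exact mul_sub_le_primitive_sub hφc hφmono hs hst
  simp only [← hFdef] at hfin
  have hFm : MonotoneOn F (Ici 0) := fun s hs t _ hst => by
    have h1 := hFsub s t hs hst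
    have h2 := mul_nonneg (hφnonneg s hs) (sub_nonneg.2 hst)
    linarith
  have hFma : MonotoneOn F (Ioi a) := hFm.mono fun t ht => (ha.trans ht).le
  obtain ⟨hpos, H, L, hH, hL⟩ := exists_antiderivative_inv_sqrt
    (fun t ht => (hFd t (ha.trans ht)).continuousAt.continuousWithinAt) hFma hfin
  have hHm : MonotoneOn H (Ioi a) := by
    refine monotoneOn_of_hasDerivWithinAt_nonneg (f' := fun t => (√(F t))⁻¹) (convex_Ioi a)
      (fun t ht => (hH t ht).continuousAt.continuousWithinAt) ?_
      fun t _ => inv_nonneg.2 (Real.sqrt_nonneg _)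
    rw [interior_Ioi]
    exact fun t ht => (hH t ht).hasDerivWithinAt
  have hHL : ∀ t, a < t → H t ≤ L := fun t ht =>
    ge_of_tendsto hL ((eventually_ge_atTop t).mono fun s hs => hHm ht (ht.trans_le hs) hs)
  have hm0 : 0 < m := by linarith
  rw [ENNReal.tendsto_nhds_zero]
  intro ε hε
  rcases eq_or_ne ε ⊤ with rfl | hεtop
  · exact Eventually.of_forall fun _ => le_top
  obtain ⟨e, he, rfl⟩ : ∃ e : ℝ, 0 < e ∧ ε = ENNReal.ofReal e :=
    ⟨ε.toReal, ENNReal.toReal_pos hε.ne' hεtop, (ENNReal.ofReal_toReal hεtop).symm⟩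
  have hδ : L - (√m)⁻¹ * (e / 2) < L := by
    have : 0 < (√m)⁻¹ * (e / 2) := mul_pos (inv_pos.2 (Real.sqrt_pos.2 hm0)) (by linarith)
    linarith
  filter_upwards [eventually_mul_le_of_antiderivative ha.le hFma hpos
      (fun t ht => hFle t (ha.trans ht).le) hH hL (C := 8 * m / e ^ 2) (by positivity),
    (hL.comp (tendsto_id.const_mul_atTop (two_pos : (0 : ℝ) < 2))).eventually (lt_mem_nhds hδ),
    eventually_gt_atTop a] with ρ hφρ hHρ haρ
  have hρ : 0 < ρ := ha.trans haρ
  refine sSup_le ?_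
  rintro R ⟨-, u, hsol⟩
  by_contra! heR
  obtain ⟨v, huc, hvc, hv0, hu, hv⟩ := hsol.exists_deriv he heR
  obtain ⟨hum, hb⟩ := radial_solution_bounds hm hφmono hφnonneg hFd hρ hsol.2.2.1 hv0
    (fun r hr => hsol.2.1 r ⟨hr.1, (ENNReal.ofReal_le_ofReal hr.2).trans_lt heR⟩) huc hvc hu hv
  have hhalf : e / 2 ∈ Icc 0 e := ⟨by linarith, by linarith⟩
  have hend : e ∈ Icc 0 e := ⟨he.le, le_rfl⟩
  have hsub : Icc (e / 2) e ⊆ Icc 0 e := Icc_subset_Icc_left hhalf.1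
  have h2ρ : 2 * ρ ≤ u (e / 2) := by
    have h1 := (hb _ hhalf).2.1
    have h2 : ρ ≤ φ ρ * (e / 2) ^ 2 / (2 * m) := by
      rw [div_mul_eq_mul_div, div_le_iff₀ (by positivity)] at hφρ
      rw [le_div_iff₀ (by positivity)]
      linarith
    linarith
  have hlow : ∀ r ∈ Icc (e / 2) e, 2 * ρ ≤ u r := fun r hr =>
    h2ρ.trans (hum hhalf (hsub hr) hr.1)
  have hgrow : ∀ r ∈ Icc (e / 2) e, (√m)⁻¹ ≤ (√(F (u r)))⁻¹ * v r := by
    intro r hr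
    have hur := hlow r hr
    have hFpos := hpos (u r) (by linarith)
    have h1 : 2 * F ρ ≤ F (u r) := by
      have h2 := hFsub ρ (u r) hρ.le (by linarith)
      have h3 := hFle ρ hρ.le
      have h4 : φ ρ * ρ ≤ φ ρ * (u r - ρ) :=
        mul_le_mul_of_nonneg_left (by linarith) (hφnonneg ρ hρ.le)
      linarith
    obtain ⟨hv0, -, hen⟩ := hb r (hsub hr)
    have h2 : F (u r) / m ≤ v r ^ 2 := by
      refine le_trans ?_ hen
      rw [div_mul_eq_mul_div]
      exact div_le_div_of_nonneg_right (by linarith) hm0.le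
    have h3 : √(F (u r)) / √m ≤ v r := by
      rw [← Real.sqrt_div hFpos.le]
      exact Real.sqrt_le_iff.2 ⟨hv0, h2⟩
    have h4 := Real.sqrt_pos.2 hFpos
    rw [inv_mul_eq_div, le_div_iff₀ h4, inv_mul_eq_div]
    exact h3
  have hmon : MonotoneOn (fun r => H (u r) - (√m)⁻¹ * r) (Icc (e / 2) e) := by
    have hua : ∀ r ∈ Icc (e / 2) e, a < u r := fun r hr => by linarith [hlow r hr]
    refine monotoneOn_Icc_of_hasDerivAt_nonneg
      (ContinuousOn.sub (fun r hr => (hH _ (hua r hr)).continuousAt.comp_continuousWithinAt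
        ((huc r (hsub hr)).mono hsub)) (continuousOn_const.mul continuousOn_id))
      (fun r hr => ((hH _ (hua r (Ioo_subset_Icc_self hr))).comp r
        (hu r ⟨hhalf.1.trans_lt hr.1, hr.2⟩)).sub ((hasDerivAt_id r).const_mul (√m)⁻¹))
      fun r hr => ?_
    linarith [hgrow r (Ioo_subset_Icc_self hr)]
  have h1 := hmon (left_mem_Icc.2 hhalf.2) (right_mem_Icc.2 hhalf.2) hhalf.2
  have h2 := hHL (u e) (by linarith [hlow e ⟨hhalf.2, le_rfl⟩])
  have h3 : H (2 * ρ) ≤ H (u (e / 2)) :=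
    hHm (by simp only [mem_Ioi]; linarith) (by simp only [mem_Ioi]; linarith) h2ρ
  simp only [Function.comp_apply, id] at hHρ h1
  linarith
end
end
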